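/- Consider the independent parallel Gaussian two-level security wiretap channel with L subchannels and gains a_l, b_{1,l}, b_{2,l} (b_{1,l} ≥ b_{2,l} ≥ 0), where the input is subject to the average total power constraint ∑_{l=1}^L (1/n)∑_{i=1}^n (X_l[i])^2 ≤ P. The secrecy capacity region of the channel equals the union over all power allocations (P_1,…,P_L) with P_l ≥ 0 and ∑_{l=1}^L P_l ≤ P of the set of nonnegative pairs (R1,R2) satisfying R1 ≤ ∑_{l=1}^L Cs(P_l,a_l,b_{1,l}) and R1 + R2 ≤ ∑_{l=1}^L Cs(P_l,a_l,b_{2,l}), where Cs(P,a,b) := [ (1/2)log(1+aP) − (1/2)log(1+bP) ]^+. -/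

import Mathlib

open MeasureTheory ProbabilityTheory
open scoped BigOperators ENNReal
noncomputable section

/-- Kullback–Leibler divergence (in bits) of `μ` from `ν`. -/
def klDivBits {Ω : Type*} [MeasurableSpace Ω] (μ ν : Measure Ω) : ℝ :=
  ∫ ω, Real.logb 2 ((μ.rnDeriv ν ω).toReal) ∂μ

/-- Mutual information (in bits) of a joint law on `α × β`: the KL divergence between the
joint law and the product of its marginals. -/
def miBits {α β : Type*} [MeasurableSpace α] [MeasurableSpace β]
    (μ : Measure (α × β)) : ℝ :=
  klDivBits μ ((μ.map Prod.fst).prod (μ.map Prod.snd))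

/-- Law of the outputs of `L` independent parallel memoryless Gaussian channels with
gains `g l` on the input sequences `xs` (time index first, subchannel index second). -/
def parOut {n L : ℕ} (g : Fin L → ℝ) (xs : Fin n → Fin L → ℝ) :
    Measure (Fin n → Fin L → ℝ) :=
  Measure.pi fun i => Measure.pi fun l => gaussianReal (Real.sqrt (g l) * xs i l) 1

/-- Joint law of the (uniform, independent) message pair and the length-`n` outputs of
the `L` independent parallel Gaussian channels with gains `g`, for the encoder `enc`. -/
def jointLawPar {n L K₁ K₂ : ℕ} (g : Fin L → ℝ)
    (enc : Fin K₁ × Fin K₂ → Measure (Fin n → Fin L → ℝ)) :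
    Measure ((Fin K₁ × Fin K₂) × (Fin n → Fin L → ℝ)) :=
  ((K₁ : ℝ≥0∞) * (K₂ : ℝ≥0∞))⁻¹ •
    Measure.sum fun m : Fin K₁ × Fin K₂ =>
      (Measure.dirac m).prod ((enc m).bind (parOut g))

/-- Achievability of `(R₁,R₂)` for the independent parallel Gaussian two-level security
wiretap channel with legitimate gains `a`, eavesdropper gains `b₁` and `b₂`, under the
input constraint described by the set `PowOK n` (the set of admissible input sequences of
blocklength `n`). -/
def ParAchievable (L : ℕ) (a b₁ b₂ : Fin L → ℝ)
    (PowOK : (n : ℕ) → Set (Fin n → Fin L → ℝ)) (R₁ R₂ : ℝ) : Prop :=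
  ∀ ε > 0, ∃ n : ℕ, 0 < n ∧ ∃ K₁ K₂ : ℕ, 0 < K₁ ∧ 0 < K₂ ∧
    (n : ℝ) * (R₁ - ε) ≤ Real.logb 2 K₁ ∧ (n : ℝ) * (R₂ - ε) ≤ Real.logb 2 K₂ ∧
    ∃ enc : Fin K₁ × Fin K₂ → Measure (Fin n → Fin L → ℝ),
      (∀ m, IsProbabilityMeasure (enc m)) ∧
      (∀ m, enc m (PowOK n) = 1) ∧
      ∃ dec : (Fin n → Fin L → ℝ) → Fin K₁ × Fin K₂, Measurable dec ∧
        (jointLawPar a enc {p | dec p.2 ≠ p.1}).toReal ≤ ε ∧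
        miBits (jointLawPar b₂ enc) ≤ (n : ℝ) * ε ∧
        miBits ((jointLawPar b₁ enc).map fun p => (p.1.1, p.2)) ≤ (n : ℝ) * ε

/-- The average individual per-subchannel power constraint `(1/n) ∑ i, (X_l[i])² ≤ P_l`. -/
def perSubPow (L : ℕ) (P : Fin L → ℝ) : (n : ℕ) → Set (Fin n → Fin L → ℝ) :=
  fun n => {xs | ∀ l, ∑ i, (xs i l) ^ 2 ≤ (n : ℝ) * P l}

/-- The average total power constraint `∑ l, (1/n) ∑ i, (X_l[i])² ≤ P`. -/
def totalPow (L : ℕ) (P : ℝ) : (n : ℕ) → Set (Fin n → Fin L → ℝ) :=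
  fun n => {xs | ∑ l, ∑ i, (xs i l) ^ 2 ≤ (n : ℝ) * P}

/-- The secrecy capacity `Cs(P,a,b)` of the scalar Gaussian wiretap channel. -/
def Cs (P a b : ℝ) : ℝ :=
  max 0 ((1 / 2) * Real.logb 2 (1 + a * P) - (1 / 2) * Real.logb 2 (1 + b * P))

namespace WT
open InformationTheory

variable {α β : Type*} [MeasurableSpace α] [MeasurableSpace β]

lemma kl_equiv (e : α ≃ᵐ β) (μ ν : Measure α) [IsFiniteMeasure μ] [IsFiniteMeasure ν] :
    klDiv (μ.map e) (ν.map e) = klDiv μ ν := by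
  apply le_antisymm (klDiv_map_le μ ν e.measurable)
  have h := klDiv_map_le (μ.map e) (ν.map e) e.symm.measurable
  simpa [Measure.map_map e.symm.measurable e.measurable] using h

lemma kl_swap (μ ν : Measure (α × β)) [IsFiniteMeasure μ] [IsFiniteMeasure ν] :
    klDiv (μ.map Prod.swap) (ν.map Prod.swap) = klDiv μ ν :=
  kl_equiv MeasurableEquiv.prodComm μ ν

lemma kl_compensation [StandardBorelSpace α] [Nonempty α] (J : Measure (α × β))
    [IsProbabilityMeasure J] (Q : Measure β) [IsProbabilityMeasure Q] :
    klDiv J (J.fst.prod Q) = klDiv J.snd Q + klDiv J (J.fst.prod J.snd) := by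
  have key : ∀ Q : Measure β, IsProbabilityMeasure Q → klDiv J (J.fst.prod Q) =
      klDiv J.snd Q + klDiv (J.snd ⊗ₘ (J.map Prod.swap).condKernel)
        (J.snd ⊗ₘ Kernel.const β J.fst) := by
    intro Q hQ
    rw [← kl_swap J, Measure.prod_swap]
    have h1 : J.map Prod.swap = J.snd ⊗ₘ (J.map Prod.swap).condKernel := by
      conv_lhs => rw [← (J.map Prod.swap).disintegrate (J.map Prod.swap).condKernel]
      rw [Measure.fst_map_swap]
    conv_lhs => rw [h1, ← Measure.compProd_const]
    rw [klDiv_compProd_eq_add]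
  rw [key Q inferInstance, key J.snd inferInstance, klDiv_self, zero_add]

lemma kl_mix (μ : Measure α) [IsProbabilityMeasure μ] (Q : Measure β) [IsProbabilityMeasure Q]
    (κ : Kernel α β) [IsMarkovKernel κ] (f : α × β → ℝ≥0∞) (hf : Measurable f)
    (h : ∀ a, κ a = Q.withDensity (fun y => f (a, y))) :
    klDiv (μ ⊗ₘ κ) (μ.prod Q) = ∫⁻ a, klDiv (κ a) Q ∂μ := by
  have h1 : μ ⊗ₘ κ = (μ.prod Q).withDensity f := by
    ext s hs
    rw [Measure.compProd_apply hs, withDensity_apply _ hs, ← lintegral_indicator hs,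
      lintegral_prod _ (hf.indicator hs).aemeasurable]
    refine lintegral_congr fun a => ?_
    rw [h a, withDensity_apply _ (measurable_prodMk_left hs),
      ← lintegral_indicator (measurable_prodMk_left hs)]
    rfl
  have h2 : ∀ a, κ a ≪ Q := fun a => by rw [h a]; exact withDensity_absolutelyContinuous _ _
  have h3 : μ ⊗ₘ κ ≪ μ.prod Q := by rw [h1]; exact withDensity_absolutelyContinuous _ _
  have hm : Measurable fun p => ENNReal.ofReal (klFun (f p).toReal) := by fun_prop
  rw [klDiv_eq_lintegral_klFun_of_ac h3]
  have h4 : ∫⁻ p, ENNReal.ofReal (klFun ((μ ⊗ₘ κ).rnDeriv (μ.prod Q) p).toReal) ∂(μ.prod Q)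
      = ∫⁻ p, ENNReal.ofReal (klFun (f p).toReal) ∂(μ.prod Q) := by
    refine lintegral_congr_ae ?_
    rw [h1]
    filter_upwards [Measure.rnDeriv_withDensity (μ.prod Q) hf] with p hp
    rw [hp]
  rw [h4, lintegral_prod _ hm.aemeasurable]
  refine lintegral_congr fun a => ?_
  rw [klDiv_eq_lintegral_klFun_of_ac (h2 a)]
  refine lintegral_congr_ae ?_
  have hfa : Measurable fun y => f (a, y) := by fun_prop
  rw [h a]
  filter_upwards [Measure.rnDeriv_withDensity Q hfa] with p hp
  rw [hp]

lemma kl_event (μ ν : Measure α) [IsProbabilityMeasure μ] [IsProbabilityMeasure ν]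
    (h : klDiv μ ν ≠ ⊤) {E : Set α} (hE : MeasurableSet E) (t : ℝ) :
    t * μ.real E - Real.log (1 + (Real.exp t - 1) * ν.real E) ≤ (klDiv μ ν).toReal := by
  obtain ⟨hac, hint⟩ := klDiv_ne_top_iff.mp h
  set φ : α → ℝ := E.indicator (fun _ => t) with hφ
  have hφm : Measurable φ := measurable_const.indicator hE
  have hφi : Integrable φ μ := (integrable_const t).indicator hE
  have he : (fun x => Real.exp (φ x)) = fun x => 1 + E.indicator (fun _ => Real.exp t - 1) x := by
    ext x
    by_cases hx : x ∈ E <;> simp [hφ, hx]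
  have hei : Integrable (fun x => Real.exp (φ x)) ν := by
    rw [he]
    exact (integrable_const 1).add ((integrable_const _).indicator hE)
  have h1 := integral_llr_tilted_right hac hφi hei hint
  have hi1 : ∫ x, φ x ∂μ = t * μ.real E := by
    rw [hφ, integral_indicator_const _ hE]; simp [mul_comm]
  have hi2 : ∫ x, Real.exp (φ x) ∂ν = 1 + (Real.exp t - 1) * ν.real E := by
    rw [he, integral_add (integrable_const 1) ((integrable_const _).indicator hE),
      integral_indicator_const _ hE]; simp [mul_comm]
  have hp : IsProbabilityMeasure (ν.tilted φ) := isProbabilityMeasure_tilted hei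
  have h2 := integral_llr_add_sub_measure_univ_nonneg
    (hac.trans (absolutelyContinuous_tilted hei)) (integrable_llr_tilted_right hac hφi hint hei)
  have h3 := toReal_klDiv_of_measure_eq hac (by simp)
  rw [hi1, hi2] at h1
  simp only [probReal_univ] at h2
  linarith

lemma kl_withDensity_exp (Q : Measure α) [IsProbabilityMeasure Q] (h : α → ℝ) (hm : Measurable h)
    (P : Measure α) [IsProbabilityMeasure P]
    (hP : P = Q.withDensity (fun y => ENNReal.ofReal (Real.exp (h y)))) (hi : Integrable h P) :
    klDiv P Q = ENNReal.ofReal (∫ y, h y ∂P) := by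
  have hac : P ≪ Q := by rw [hP]; exact withDensity_absolutelyContinuous _ _
  have hl : llr P Q =ᵐ[P] h := by
    refine hac.ae_le ?_
    have hm' : Measurable fun y => ENNReal.ofReal (Real.exp (h y)) := by fun_prop
    have := Measure.rnDeriv_withDensity Q hm'
    rw [← hP] at this
    filter_upwards [this] with y hy
    simp [llr, hy, ENNReal.toReal_ofReal (Real.exp_pos _).le]
  have hi' : Integrable (llr P Q) P := (integrable_congr hl).mpr hi
  rw [klDiv_of_ac_of_integrable hac hi', integral_congr_ae hl]
  simp

lemma kl_prod (μ₁ ν₁ : Measure α) (μ₂ ν₂ : Measure β) [IsProbabilityMeasure μ₁]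
    [IsProbabilityMeasure ν₁] [IsProbabilityMeasure μ₂] [IsProbabilityMeasure ν₂] :
    klDiv (μ₁.prod μ₂) (ν₁.prod ν₂) = klDiv μ₁ ν₁ + klDiv μ₂ ν₂ := by
  rw [← Measure.compProd_const, ← Measure.compProd_const, klDiv_compProd_eq_add]
  congr 1
  rw [Measure.compProd_const, Measure.compProd_const, ← kl_swap, Measure.prod_swap,
    Measure.prod_swap, ← Measure.compProd_const, ← Measure.compProd_const, klDiv_compProd_left]

lemma kl_pi {n : ℕ} {X : Fin n → Type*} [∀ i, MeasurableSpace (X i)]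
    (μ ν : ∀ i, Measure (X i)) [∀ i, IsProbabilityMeasure (μ i)]
    [∀ i, IsProbabilityMeasure (ν i)] :
    klDiv (Measure.pi μ) (Measure.pi ν) = ∑ i, klDiv (μ i) (ν i) := by
  induction n with
  | zero => 
    rw [Measure.pi_of_empty μ, Measure.pi_of_empty ν, klDiv_self]; simp
  | succ n ih =>
    have h1 := (measurePreserving_piFinSuccAbove μ 0).map_eq
    have h2 := (measurePreserving_piFinSuccAbove ν 0).map_eq
    rw [← kl_equiv (MeasurableEquiv.piFinSuccAbove X 0), h1, h2, kl_prod, ih, Fin.sum_univ_succ]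
    simp
    rfl

end WT

namespace WT
open InformationTheory

section PiKernel
variable {ι : Type*} [Fintype ι] {X Y : ι → Type*} [∀ i, MeasurableSpace (X i)]
  [∀ i, MeasurableSpace (Y i)]

lemma lintegral_pi_prod (μ : ∀ i, Measure (X i)) [∀ i, IsProbabilityMeasure (μ i)]
    (f : ∀ i, X i → ℝ≥0∞) (hf : ∀ i, Measurable (f i)) :
    ∫⁻ x, ∏ i, f i (x i) ∂(Measure.pi μ) = ∏ i, ∫⁻ x, f i x ∂(μ i) := by
  refine (lintegral_prod_eq_prod_lintegral_of_indepFun (μ := Measure.pi μ) Finset.univ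
    (fun i x => f i (x i)) (iIndepFun_pi fun i => (hf i).aemeasurable)
    (fun i => (hf i).comp (measurable_pi_apply i))).trans ?_
  refine Finset.prod_congr rfl fun i _ => ?_
  rw [← (measurePreserving_eval μ i).map_eq, lintegral_map (hf i) (measurable_pi_apply i)]

/-- product of kernels -/
def piK (κ : ∀ i, Kernel (X i) (Y i)) [∀ i, IsMarkovKernel (κ i)] :
    Kernel (∀ i, X i) (∀ i, Y i) where
  toFun x := Measure.pi fun i => κ i (x i)
  measurable' := by
    refine Measurable.measure_of_isPiSystem_of_isProbabilityMeasure
      generateFrom_pi.symm isPiSystem_pi ?_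
    rintro s ⟨t, ht, rfl⟩
    simp only [Measure.pi_pi]
    refine Finset.measurable_prod _ fun i _ => ?_
    exact ((κ i).measurable_coe (ht i (Set.mem_univ i))).comp (measurable_pi_apply i)

lemma piK_apply (κ : ∀ i, Kernel (X i) (Y i)) [∀ i, IsMarkovKernel (κ i)] (x : ∀ i, X i) :
    piK κ x = Measure.pi fun i => κ i (x i) := rfl

instance (κ : ∀ i, Kernel (X i) (Y i)) [∀ i, IsMarkovKernel (κ i)] :
    IsMarkovKernel (piK κ) := ⟨fun x => by rw [piK_apply]; infer_instance⟩

lemma pi_bind (μ : ∀ i, Measure (X i)) [∀ i, IsProbabilityMeasure (μ i)]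
    (κ : ∀ i, Kernel (X i) (Y i)) [∀ i, IsMarkovKernel (κ i)] :
    (Measure.pi μ).bind (piK κ) = Measure.pi fun i => (μ i).bind (κ i) := by
  refine (Measure.pi_eq fun s hs => ?_).symm
  rw [Measure.bind_apply (MeasurableSet.univ_pi hs) (piK κ).aemeasurable]
  simp only [piK_apply, Measure.pi_pi]
  rw [lintegral_pi_prod μ (fun i x => κ i x (s i)) (fun i => (κ i).measurable_coe (hs i))]
  refine Finset.prod_congr rfl fun i _ => ?_
  rw [Measure.bind_apply (hs i) (κ i).aemeasurable]

lemma pi_withDensity (Q : ∀ i, Measure (X i)) [∀ i, IsProbabilityMeasure (Q i)]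
    (f : ∀ i, X i → ℝ≥0∞) (hf : ∀ i, Measurable (f i))
    [∀ i, SigmaFinite ((Q i).withDensity (f i))] :
    Measure.pi (fun i => (Q i).withDensity (f i)) =
      (Measure.pi Q).withDensity (fun y => ∏ i, f i (y i)) := by
  refine Measure.pi_eq fun s hs => ?_
  rw [withDensity_apply _ (MeasurableSet.univ_pi hs), ← lintegral_indicator (MeasurableSet.univ_pi hs)]
  have : (Set.univ.pi s).indicator (fun y => ∏ i, f i (y i)) =
      fun y => ∏ i, (s i).indicator (f i) (y i) := by
    ext y
    by_cases hy : y ∈ Set.univ.pi s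
    · rw [Set.indicator_of_mem hy]
      refine Finset.prod_congr rfl fun i _ => ?_
      rw [Set.indicator_of_mem (hy i (Set.mem_univ i))]
    · rw [Set.indicator_of_notMem hy]
      simp only [Set.mem_pi, Set.mem_univ, true_imp_iff, not_forall] at hy
      obtain ⟨i, hi⟩ := hy
      exact (Finset.prod_eq_zero (Finset.mem_univ i) (Set.indicator_of_notMem hi _)).symm
  rw [this, lintegral_pi_prod Q _ fun i => (hf i).indicator (hs i)]
  refine Finset.prod_congr rfl fun i _ => ?_
  rw [withDensity_apply _ (hs i), lintegral_indicator (hs i)]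

/-- the kernel has a jointly measurable density w.r.t. `Q` -/
def HasDens {α β : Type*} [MeasurableSpace α] [MeasurableSpace β] (κ : Kernel α β)
    (Q : Measure β) : Prop :=
  ∃ f : α × β → ℝ≥0∞, Measurable f ∧ ∀ a, κ a = Q.withDensity (fun y => f (a, y))

lemma hasDens_piK (κ : ∀ i, Kernel (X i) (Y i)) [∀ i, IsMarkovKernel (κ i)]
    (Q : ∀ i, Measure (Y i)) [∀ i, IsProbabilityMeasure (Q i)] (h : ∀ i, HasDens (κ i) (Q i)) :
    HasDens (piK κ) (Measure.pi Q) := by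
  choose f hf hfe using h
  refine ⟨fun p => ∏ i, f i (p.1 i, p.2 i), ?_, fun x => ?_⟩
  · refine Finset.measurable_prod _ fun i _ => (hf i).comp ?_
    fun_prop
  · rw [piK_apply]
    have : ∀ i, SigmaFinite ((Q i).withDensity (fun y => f i (x i, y))) := fun i => by
      rw [← hfe]; infer_instance
    rw [← pi_withDensity Q (fun i y => f i (x i, y)) fun i => (hf i).comp measurable_prodMk_left]
    congr 1; ext1 i; exact hfe i _

end PiKernel

section Gauss
open NNReal

lemma gauss_density (m : ℝ) (v : ℝ≥0) (hv : v ≠ 0) :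
    gaussianReal m 1 = (gaussianReal 0 v).withDensity (fun y => ENNReal.ofReal (Real.exp
      (Real.log v / 2 - (y - m) ^ 2 / 2 + y ^ 2 / (2 * v)))) := by
  rw [gaussianReal_of_var_ne_zero _ one_ne_zero, gaussianReal_of_var_ne_zero _ hv,
    ← withDensity_mul _ (measurable_gaussianPDF _ _) (by fun_prop)]
  congr 1
  ext y
  have hv' : (0 : ℝ) < v := by positivity
  simp only [Pi.mul_apply, gaussianPDF]
  rw [← ENNReal.ofReal_mul (gaussianPDFReal_nonneg _ _ _)]
  congr 1
  simp only [gaussianPDFReal, NNReal.coe_one, mul_one, sub_zero]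
  have hs : √(2 * Real.pi * v) = √(2 * Real.pi) * √(v : ℝ) := Real.sqrt_mul (by positivity) _
  rw [hs, mul_assoc, ← Real.exp_add, mul_inv, mul_assoc]
  congr 1
  have : (√(v : ℝ))⁻¹ = Real.exp (-(Real.log v / 2)) := by
    rw [Real.exp_neg, Real.sqrt_eq_rpow, Real.rpow_def_of_pos hv']
    congr 2; ring
  rw [this, ← Real.exp_add]
  congr 1
  field_simp
  ring

lemma integral_sq_gauss (m : ℝ) (v : ℝ≥0) : ∫ y, y ^ 2 ∂(gaussianReal m v) = v + m ^ 2 := by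
  have h := variance_fun_id_gaussianReal (μ := m) (v := v)
  rw [variance_eq_sub (X := fun x : ℝ => x) (memLp_id_gaussianReal 2)] at h
  simp [integral_id_gaussianReal] at h
  linarith

lemma gauss_kl (m : ℝ) (v : ℝ≥0) (hv : v ≠ 0) :
    klDiv (gaussianReal m 1) (gaussianReal 0 v) =
      ENNReal.ofReal (Real.log v / 2 + (1 + m ^ 2) / (2 * v) - 1 / 2) := by
  have h2 : Integrable (fun y : ℝ => y ^ 2) (gaussianReal m 1) :=
    (memLp_id_gaussianReal 2).integrable_sq
  have h1 : Integrable (fun y : ℝ => y) (gaussianReal m 1) :=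
    (memLp_id_gaussianReal 1).integrable le_rfl
  have h3 : Integrable (fun y : ℝ => (y - m) ^ 2) (gaussianReal m 1) :=
    (((memLp_id_gaussianReal 2).sub (memLp_const m))).integrable_sq
  have h4 : ∫ y, (y - m) ^ 2 ∂(gaussianReal m 1) = 1 := by
    have h := variance_fun_id_gaussianReal (μ := m) (v := 1)
    rw [variance_eq_integral (by fun_prop)] at h
    simpa [integral_id_gaussianReal] using h
  have h5 : Integrable (fun y : ℝ => Real.log v / 2 - (y - m) ^ 2 / 2) (gaussianReal m 1) :=
    (integrable_const _).sub (h3.div_const 2)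
  rw [kl_withDensity_exp (gaussianReal 0 v) _ (by fun_prop) _ (gauss_density m v hv)
    (h5.add (h2.div_const _)), integral_add h5 (h2.div_const _),
    integral_sub (integrable_const _) (h3.div_const _), integral_div _ (fun y => (y - m) ^ 2), integral_div _ (fun y => y ^ 2), h4,
    integral_sq_gauss]
  simp
  congr 1
  ring

/-- scalar Gaussian channel -/
def gK (g : ℝ) : Kernel ℝ ℝ where
  toFun x := gaussianReal (√g * x) 1
  measurable' := by
    exact measurable_gaussianReal.comp (by fun_prop : Measurable fun x : ℝ => (√g * x, (1 : ℝ≥0)))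

lemma gK_apply (g x : ℝ) : gK g x = gaussianReal (√g * x) 1 := rfl

instance (g : ℝ) : IsMarkovKernel (gK g) := ⟨fun x => by rw [gK_apply]; infer_instance⟩

lemma hasDens_gK (g : ℝ) (v : ℝ≥0) (hv : v ≠ 0) : HasDens (gK g) (gaussianReal 0 v) :=
  ⟨fun p => ENNReal.ofReal (Real.exp
      (Real.log v / 2 - (p.2 - √g * p.1) ^ 2 / 2 + p.2 ^ 2 / (2 * v))), by fun_prop,
    fun x => gauss_density _ v hv⟩

/-- linear Gaussian kernel -/
def linK (c : ℝ) (w : ℝ≥0) : Kernel ℝ ℝ where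
  toFun x := gaussianReal (c * x) w
  measurable' := by
    exact measurable_gaussianReal.comp (by fun_prop : Measurable fun x : ℝ => (c * x, w))

lemma linK_apply (c : ℝ) (w : ℝ≥0) (x : ℝ) : linK c w x = gaussianReal (c * x) w := rfl

instance (c : ℝ) (w : ℝ≥0) : IsMarkovKernel (linK c w) :=
  ⟨fun x => by rw [linK_apply]; infer_instance⟩

lemma gauss_bind_linK (m c : ℝ) (v w : ℝ≥0) :
    (gaussianReal m v).bind (linK c w) = gaussianReal (c * m) (NNReal.mk (c ^ 2) (sq_nonneg c) * v + w) := by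
  have h := gaussianReal_conv_gaussianReal (m₁ := c * m) (m₂ := 0)
    (v₁ := NNReal.mk (c ^ 2) (sq_nonneg c) * v) (v₂ := w)
  rw [add_zero] at h
  rw [← h, ← gaussianReal_map_const_mul, Measure.conv]
  ext s hs
  rw [Measure.bind_apply hs (linK c w).aemeasurable, Measure.map_apply (by fun_prop) hs,
    Measure.prod_apply (measurable_add hs)]
  rw [lintegral_map]
  · refine lintegral_congr fun x => ?_
    rw [linK_apply]
    have h2 := gaussianReal_map_const_add (μ := 0) (v := w) (c * x)
    rw [zero_add] at h2
    rw [← h2, Measure.map_apply (by fun_prop) hs]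
    rfl
  · exact measurable_measure_prodMk_left (measurable_add hs)
  · fun_prop

lemma gK_eq_linK (g : ℝ) : gK g = linK (√g) 1 := rfl

lemma gauss_bind_gK (g P : ℝ) (hg : 0 ≤ g) (hP : 0 ≤ P) :
    (gaussianReal 0 P.toNNReal).bind (gK g) = gaussianReal 0 (1 + g * P).toNNReal := by
  rw [gK_eq_linK, gauss_bind_linK, mul_zero]
  congr 1
  ext
  simp [Real.sq_sqrt hg, hP]
  rw [max_eq_left (by positivity)]; ring

lemma gK_degrade (a b : ℝ) (hb : 0 ≤ b) (hab : b ≤ a) (x : ℝ) :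
    (gK a x).bind (linK (√(b / a)) (1 - b / a).toNNReal) = gK b x := by
  rw [gK_apply, gauss_bind_linK, gK_apply]
  have ha : 0 ≤ a := hb.trans hab
  rcases eq_or_lt_of_le ha with h | h
  · have : b = 0 := by linarith
    subst this; subst h
    simp
  · have h1 : b / a ≤ 1 := by rw [div_le_one h]; exact hab
    congr 1
    · rw [← mul_assoc, ← Real.sqrt_mul (by positivity), div_mul_cancel₀ _ h.ne']
    · ext
      simp [Real.sq_sqrt (show 0 ≤ b / a by positivity), h1]

end Gauss
end WT

namespace WT
open InformationTheory

section MI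
variable {M X Y Z : Type*} [MeasurableSpace M] [MeasurableSpace X] [MeasurableSpace Y]
  [MeasurableSpace Z]

/-- mutual information (in nats, extended) of input law `μ` and channel `κ` -/
def miK (μ : Measure X) (κ : Kernel X Y) : ℝ≥0∞ := klDiv (μ ⊗ₘ κ) (μ.prod (κ ∘ₘ μ))

lemma mi_base [StandardBorelSpace X] [Nonempty X] (μ : Measure X) [IsProbabilityMeasure μ]
    (κ : Kernel X Y) [IsMarkovKernel κ] (Q : Measure Y) [IsProbabilityMeasure Q]
    (h : HasDens κ Q) :
    ∫⁻ a, klDiv (κ a) Q ∂μ = klDiv (κ ∘ₘ μ) Q + miK μ κ := by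
  obtain ⟨f, hf, hfe⟩ := h
  rw [← kl_mix μ Q κ f hf hfe]
  have := kl_compensation (μ ⊗ₘ κ) Q
  rwa [Measure.fst_compProd, Measure.snd_compProd] at this

lemma mi_dpi (μ : Measure X) [IsProbabilityMeasure μ]
    (κ : Kernel X Y) [IsMarkovKernel κ] (V : Kernel Y Z) [IsMarkovKernel V] :
    miK μ (V ∘ₖ κ) ≤ miK μ κ := by
  have h := klDiv_comp_right_le (μ ⊗ₘ κ) (μ.prod (κ ∘ₘ μ)) (Kernel.id ∥ₖ V)
  rw [Measure.parallelComp_comp_compProd, ← Measure.compProd_const,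
    Measure.parallelComp_comp_compProd, Kernel.comp_const, Measure.compProd_const,
    Measure.comp_assoc, Measure.compProd_const] at h
  exact h

lemma hasDens_comp (E : Kernel M X) [IsMarkovKernel E] (W : Kernel X Y) [IsMarkovKernel W]
    (Q : Measure Y) [IsProbabilityMeasure Q] (h : HasDens W Q) : HasDens (W ∘ₖ E) Q := by
  obtain ⟨f, hf, hfe⟩ := h
  refine ⟨fun p => ∫⁻ x, f (x, p.2) ∂(E p.1), ?_, fun m => ?_⟩
  · have : Measurable (fun q : (M × Y) × X => f (q.2, q.1.2)) := by fun_prop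
    exact this.lintegral_kernel_prod_right' (κ := E.comap Prod.fst measurable_fst)
  · ext s hs
    rw [Kernel.comp_apply' _ _ _ hs, withDensity_apply _ hs]
    dsimp only
    rw [lintegral_lintegral_swap]
    · refine lintegral_congr fun x => ?_
      rw [hfe, withDensity_apply _ hs]
    · have : Measurable (fun q : Y × X => f (q.2, q.1)) := by fun_prop
      exact this.aemeasurable

variable [Countable M] [MeasurableSingletonClass M]

lemma mi_golden [StandardBorelSpace X] [Nonempty X] [StandardBorelSpace M] [Nonempty M]
    (ν : Measure M) [IsProbabilityMeasure ν]
    (E : Kernel M X) [IsMarkovKernel E] (W : Kernel X Y) [IsMarkovKernel W]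
    (Q : Measure Y) [IsProbabilityMeasure Q] (h : HasDens W Q) :
    ∫⁻ m, ∫⁻ x, klDiv (W x) Q ∂(E m) ∂ν = klDiv ((W ∘ₖ E) ∘ₘ ν) Q + miK ν (W ∘ₖ E) +
      ∫⁻ m, miK (E m) W ∂ν := by
  rw [← mi_base ν _ Q (hasDens_comp E W Q h), ← lintegral_add_left (measurable_of_countable _)]
  refine lintegral_congr fun m => ?_
  rw [mi_base (E m) W Q h, Kernel.comp_apply]

lemma mi_wiretap [StandardBorelSpace X] [Nonempty X] [StandardBorelSpace M] [Nonempty M]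
    (ν : Measure M) [IsProbabilityMeasure ν]
    (E : Kernel M X) [IsMarkovKernel E] (W : Kernel X Y) [IsMarkovKernel W]
    (V : Kernel Y Z) [IsMarkovKernel V]
    (Q : Measure Y) [IsProbabilityMeasure Q] (h : HasDens W Q)
    (h' : HasDens (V ∘ₖ W) (V ∘ₘ Q)) :
    miK ν (W ∘ₖ E) + ∫⁻ m, ∫⁻ x, klDiv ((V ∘ₖ W) x) (V ∘ₘ Q) ∂(E m) ∂ν ≤
    miK ν ((V ∘ₖ W) ∘ₖ E) + ∫⁻ m, ∫⁻ x, klDiv (W x) Q ∂(E m) ∂ν := by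
  rw [mi_golden ν E W Q h, mi_golden ν E (V ∘ₖ W) (V ∘ₘ Q) h']
  have h1 : klDiv (((V ∘ₖ W) ∘ₖ E) ∘ₘ ν) (V ∘ₘ Q) ≤ klDiv ((W ∘ₖ E) ∘ₘ ν) Q := by
    rw [Kernel.comp_assoc, ← Measure.comp_assoc]
    exact klDiv_comp_right_le _ _ _
  have h2 : ∫⁻ m, miK (E m) (V ∘ₖ W) ∂ν ≤ ∫⁻ m, miK (E m) W ∂ν :=
    lintegral_mono fun m => mi_dpi _ _ _
  calc _ ≤ miK ν (W ∘ₖ E) + (klDiv ((W ∘ₖ E) ∘ₘ ν) Q + miK ν ((V ∘ₖ W) ∘ₖ E) + 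
        ∫⁻ m, miK (E m) W ∂ν) := by gcongr
    _ = _ := by ring

end MI

section Par
variable {n L : ℕ}

/-- kernel of the parallel channel -/
def parK (n : ℕ) {L : ℕ} (g : Fin L → ℝ) : Kernel (Fin n → Fin L → ℝ) (Fin n → Fin L → ℝ) :=
  piK fun _ => piK fun l => gK (g l)

instance (g : Fin L → ℝ) : IsMarkovKernel (parK n g) := by unfold parK; infer_instance

lemma parK_apply (g : Fin L → ℝ) (x : Fin n → Fin L → ℝ) : parK n g x = parOut g x := rfl

/-- reference output law -/
def parQ (n : ℕ) {L : ℕ} (v : Fin L → NNReal) : Measure (Fin n → Fin L → ℝ) :=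
  Measure.pi fun _ => Measure.pi fun l => gaussianReal 0 (v l)

instance (v : Fin L → NNReal) : IsProbabilityMeasure (parQ n v) := by
  unfold parQ; infer_instance

lemma hasDens_parK (g : Fin L → ℝ) (v : Fin L → NNReal) (hv : ∀ l, v l ≠ 0) :
    HasDens (parK n g) (parQ n v) :=
  hasDens_piK _ _ fun _ => hasDens_piK _ _ fun l => hasDens_gK _ _ (hv l)

/-- degradation kernel -/
def degK (n : ℕ) {L : ℕ} (a b : Fin L → ℝ) :
    Kernel (Fin n → Fin L → ℝ) (Fin n → Fin L → ℝ) :=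
  piK fun _ => piK fun l => linK (√(b l / a l)) (1 - b l / a l).toNNReal

instance (a b : Fin L → ℝ) : IsMarkovKernel (degK n a b) := by unfold degK; infer_instance

lemma degK_comp (a b : Fin L → ℝ) (hb : ∀ l, 0 ≤ b l) (hab : ∀ l, b l ≤ a l) :
    degK n a b ∘ₖ parK n a = parK n b := by
  ext1 x
  rw [Kernel.comp_apply, parK, degK, piK_apply, pi_bind, parK, piK_apply]
  congr 1; ext1 i
  rw [piK_apply, pi_bind, piK_apply]
  congr 1; ext1 l
  exact gK_degrade _ _ (hb l) (hab l) _

lemma degK_Q (a b p : Fin L → ℝ) (hb : ∀ l, 0 ≤ b l) (hab : ∀ l, b l ≤ a l) (hp : ∀ l, 0 ≤ p l) :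
    degK n a b ∘ₘ parQ n (fun l => (1 + a l * p l).toNNReal) =
      parQ n (fun l => (1 + b l * p l).toNNReal) := by
  rw [parQ, degK, pi_bind, parQ]
  congr 1; ext1 i
  rw [pi_bind]
  congr 1; ext1 l
  rw [gauss_bind_linK, mul_zero]
  congr 1
  ext
  have hb := hb l
  have hab := hab l
  have hp := hp l
  have ha := hb.trans hab
  have h0 : 0 ≤ b l / a l := by positivity
  have h1 : b l / a l ≤ 1 := by
    rcases eq_or_lt_of_le ha with h | h
    · rw [← h]; simp
    · rw [div_le_one h]; exact hab
  have h2 : b l / a l * a l = b l := by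
    rcases eq_or_lt_of_le ha with h | h
    · rw [← h]; simp; linarith
    · field_simp
  rw [NNReal.coe_add, NNReal.coe_mul, NNReal.coe_mk, Real.coe_toNNReal _ (by positivity),
    Real.coe_toNNReal _ (by linarith), Real.coe_toNNReal _ (by positivity), Real.sq_sqrt h0]
  linear_combination p l * h2

lemma kl_parK (g p : Fin L → ℝ) (hg : ∀ l, 0 ≤ g l) (hp : ∀ l, 0 ≤ p l)
    (x : Fin n → Fin L → ℝ) :
    klDiv (parK n g x) (parQ n (fun l => (1 + g l * p l).toNNReal)) =
      ENNReal.ofReal (∑ l, (n * (Real.log (1 + g l * p l) / 2) +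
        (g l / (2 * (1 + g l * p l))) * (∑ i, (x i l) ^ 2 - n * p l))) ∧
    0 ≤ (∑ l, (n * (Real.log (1 + g l * p l) / 2) +
        (g l / (2 * (1 + g l * p l))) * (∑ i, (x i l) ^ 2 - n * p l))) := by
  have hpos : ∀ l, 0 < 1 + g l * p l := fun l => by have := hg l; have := hp l; positivity
  rw [parK, parQ, piK_apply, kl_pi]
  have h : ∀ i l, klDiv (gK (g l) (x i l)) (gaussianReal 0 (1 + g l * p l).toNNReal) =
      ENNReal.ofReal (Real.log (1 + g l * p l) / 2 + 
        (g l / (2 * (1 + g l * p l))) * ((x i l) ^ 2 - p l)) := by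
    intro i l
    rw [gK_apply, gauss_kl _ _ (by simp [hpos l]), Real.coe_toNNReal _ (hpos l).le, mul_pow,
      Real.sq_sqrt (hg l)]
    congr 1
    have := hpos l
    field_simp
    ring
  have h0 : ∀ i l, 0 ≤ Real.log (1 + g l * p l) / 2 + 
        (g l / (2 * (1 + g l * p l))) * ((x i l) ^ 2 - p l) := by
    intro i l
    have h1 := Real.one_sub_inv_le_log_of_pos (hpos l)
    have h3 : 0 ≤ g l / (2 * (1 + g l * p l)) := by have := hg l; have := hpos l; positivity
    have h2 := mul_nonneg h3 (sq_nonneg (x i l))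
    have h4 : g l / (2 * (1 + g l * p l)) * p l = (1 - (1 + g l * p l)⁻¹) / 2 := by
      have := hpos l
      field_simp; ring
    nlinarith
  have he : (∑ l, (n * (Real.log (1 + g l * p l) / 2) +
        (g l / (2 * (1 + g l * p l))) * (∑ i, (x i l) ^ 2 - n * p l))) =
      ∑ i, ∑ l, (Real.log (1 + g l * p l) / 2 + 
        (g l / (2 * (1 + g l * p l))) * ((x i l) ^ 2 - p l)) := by
    rw [Finset.sum_comm]
    refine Finset.sum_congr rfl fun l _ => ?_
    rw [Finset.sum_add_distrib, ← Finset.mul_sum, Finset.sum_sub_distrib]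
    simp
  rw [he]
  refine ⟨?_, Finset.sum_nonneg fun i _ => Finset.sum_nonneg fun l _ => h0 i l⟩
  simp_rw [piK_apply, kl_pi, h]
  simp_rw [← ENNReal.ofReal_sum_of_nonneg (fun l _ => h0 _ l)]
  rw [← ENNReal.ofReal_sum_of_nonneg fun i _ => Finset.sum_nonneg fun l _ => h0 i l]
end Par
end WT

namespace WT
open InformationTheory

section Conv
variable {n L : ℕ} {M : Type*} [MeasurableSpace M] [Countable M] [MeasurableSingletonClass M]
  [StandardBorelSpace M] [Nonempty M]

/-- average power per subchannel -/
def avP (μ : Measure (Fin n → Fin L → ℝ)) (l : Fin L) : ℝ :=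
  (∫ x, ∑ i, (x i l) ^ 2 ∂μ) / n

lemma avP_nonneg (μ : Measure (Fin n → Fin L → ℝ)) (l : Fin L) : 0 ≤ avP μ l := by
  unfold avP
  have : 0 ≤ ∫ x, ∑ i, (x i l) ^ 2 ∂μ :=
    integral_nonneg fun x => Finset.sum_nonneg fun i _ => sq_nonneg _
  positivity

lemma pow_integrable (μ : Measure (Fin n → Fin L → ℝ)) [IsProbabilityMeasure μ] (P : ℝ)
    (h : ∀ᵐ x ∂μ, x ∈ totalPow L P n) (l : Fin L) : Integrable (fun x => ∑ i, (x i l) ^ 2) μ := by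
  refine Integrable.of_bound (C := n * P) (Measurable.aestronglyMeasurable (by fun_prop)) ?_
  filter_upwards [h] with x hx
  rw [Real.norm_of_nonneg (Finset.sum_nonneg fun i _ => sq_nonneg _)]
  refine le_trans ?_ hx
  exact Finset.single_le_sum (f := fun l => ∑ i, (x i l) ^ 2)
    (fun l _ => Finset.sum_nonneg fun i _ => sq_nonneg _) (Finset.mem_univ l)

lemma avP_sum (hn : 0 < n) (μ : Measure (Fin n → Fin L → ℝ)) [IsProbabilityMeasure μ] (P : ℝ)
    (h : ∀ᵐ x ∂μ, x ∈ totalPow L P n) : ∑ l, avP μ l ≤ P := by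
  unfold avP
  rw [← Finset.sum_div, ← integral_finsetSum _ fun l _ => pow_integrable μ P h l,
    div_le_iff₀ (by positivity)]
  have : ∫ x, ∑ l, ∑ i, (x i l) ^ 2 ∂μ ≤ ∫ x, (n * P) ∂μ := by
    refine integral_mono_ae (integrable_finsetSum _ fun l _ => pow_integrable μ P h l)
      (integrable_const _) h
  simp at this
  linarith

lemma lint_kl_parK (hn : 0 < n) (μ : Measure (Fin n → Fin L → ℝ)) [IsProbabilityMeasure μ] (P : ℝ)
    (h : ∀ᵐ x ∂μ, x ∈ totalPow L P n) (g : Fin L → ℝ) (hg : ∀ l, 0 ≤ g l) :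
    ∫⁻ x, klDiv (parK n g x) (parQ n (fun l => (1 + g l * avP μ l).toNNReal)) ∂μ =
      ENNReal.ofReal (∑ l, n * (Real.log (1 + g l * avP μ l) / 2)) := by
  have hk := kl_parK (n := n) g (avP μ) hg (avP_nonneg μ)
  simp_rw [fun x => (hk x).1]
  have hi : ∀ l ∈ Finset.univ, Integrable (fun x : Fin n → Fin L → ℝ => 
      (n * (Real.log (1 + g l * avP μ l) / 2) +
        (g l / (2 * (1 + g l * avP μ l))) * (∑ i, (x i l) ^ 2 - n * avP μ l))) μ := fun l _ =>
    (integrable_const _).add (((pow_integrable μ P h l).sub (integrable_const _)).const_mul _)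
  rw [← ofReal_integral_eq_lintegral_ofReal (integrable_finsetSum _ hi)
    (Filter.Eventually.of_forall fun x => (hk x).2), integral_finsetSum _ hi]
  congr 1
  refine Finset.sum_congr rfl fun l _ => ?_
  have hsub : Integrable (fun x : Fin n → Fin L → ℝ => ∑ i, (x i l) ^ 2 - n * avP μ l) μ :=
    (pow_integrable μ P h l).sub (integrable_const _)
  rw [integral_add (integrable_const _) (hsub.const_mul _), integral_const_mul, integral_const_mul,
    integral_sub (pow_integrable μ P h l) (integrable_const _)]
  have : (n : ℝ) ≠ 0 := by positivity
  simp [avP]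
  right
  field_simp
  simp

lemma miK_par_ne_top (hn : 0 < n) (ν : Measure M) [IsProbabilityMeasure ν]
    (E : Kernel M (Fin n → Fin L → ℝ)) [IsMarkovKernel E] (P : ℝ)
    (h : ∀ᵐ x ∂(E ∘ₘ ν), x ∈ totalPow L P n) (g : Fin L → ℝ) (hg : ∀ l, 0 ≤ g l) :
    miK ν (parK n g ∘ₖ E) ≠ ⊤ := by
  have h0 := mi_golden ν E (parK n g) (parQ n (fun l => (1 + g l * avP (E ∘ₘ ν) l).toNNReal))
    (hasDens_parK _ _ fun l => by
      have := hg l; have := avP_nonneg (E ∘ₘ ν) l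
      have : 0 < 1 + g l * avP (E ∘ₘ ν) l := by positivity
      simp [this])
  have h1 := lint_kl_parK hn (E ∘ₘ ν) P h g hg
  obtain ⟨f, hf, hfe⟩ := hasDens_parK (n := n) g (fun l => (1 + g l * avP (E ∘ₘ ν) l).toNNReal)
    fun l => by
      have := hg l; have := avP_nonneg (E ∘ₘ ν) l
      have : 0 < 1 + g l * avP (E ∘ₘ ν) l := by positivity
      simp [this]
  rw [Measure.lintegral_bind E.aemeasurable] at h1
  · rw [h1] at h0
    intro h2
    rw [h2] at h0
    simp at h0
  · have hk := kl_parK (n := n) g (avP (E ∘ₘ ν)) hg (avP_nonneg _)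
    simp_rw [fun x => (hk x).1]
    exact Measurable.aemeasurable (by fun_prop)

lemma conv_deg (hn : 0 < n) (ν : Measure M) [IsProbabilityMeasure ν]
    (E : Kernel M (Fin n → Fin L → ℝ)) [IsMarkovKernel E] (P : ℝ)
    (h : ∀ᵐ x ∂(E ∘ₘ ν), x ∈ totalPow L P n) (a b : Fin L → ℝ) (hb : ∀ l, 0 ≤ b l)
    (hab : ∀ l, b l ≤ a l) :
    (miK ν (parK n a ∘ₖ E)).toReal + ∑ l, n * (Real.log (1 + b l * avP (E ∘ₘ ν) l) / 2) ≤
      (miK ν (parK n b ∘ₖ E)).toReal + ∑ l, n * (Real.log (1 + a l * avP (E ∘ₘ ν) l) / 2) := by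
  have ha : ∀ l, 0 ≤ a l := fun l => (hb l).trans (hab l)
  have hv : ∀ g : Fin L → ℝ, (∀ l, 0 ≤ g l) → ∀ l, (1 + g l * avP (E ∘ₘ ν) l).toNNReal ≠ 0 := by
    intro g hg l
    have := hg l; have := avP_nonneg (E ∘ₘ ν) l
    have : 0 < 1 + g l * avP (E ∘ₘ ν) l := by positivity
    simp [this]
  have hs : ∀ g : Fin L → ℝ, (∀ l, 0 ≤ g l) →
      0 ≤ ∑ l, n * (Real.log (1 + g l * avP (E ∘ₘ ν) l) / 2) := by
    intro g hg
    refine Finset.sum_nonneg fun l _ => ?_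
    have := hg l; have := avP_nonneg (E ∘ₘ ν) l
    have : 0 ≤ Real.log (1 + g l * avP (E ∘ₘ ν) l) := Real.log_nonneg (by nlinarith)
    positivity
  have hl : ∀ g : Fin L → ℝ, (∀ l, 0 ≤ g l) → ∫⁻ m, ∫⁻ x, klDiv (parK n g x)
      (parQ n (fun l => (1 + g l * avP (E ∘ₘ ν) l).toNNReal)) ∂(E m) ∂ν = 
      ENNReal.ofReal (∑ l, n * (Real.log (1 + g l * avP (E ∘ₘ ν) l) / 2)) := by
    intro g hg
    rw [← lint_kl_parK hn (E ∘ₘ ν) P h g hg, Measure.lintegral_bind E.aemeasurable]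
    have hk := kl_parK (n := n) g (avP (E ∘ₘ ν)) hg (avP_nonneg _)
    simp_rw [fun x => (hk x).1]
    exact Measurable.aemeasurable (by fun_prop)
  have hw := mi_wiretap ν E (parK n a) (degK n a b)
    (parQ n (fun l => (1 + a l * avP (E ∘ₘ ν) l).toNNReal)) (hasDens_parK _ _ (hv a ha)) (by
      rw [degK_comp a b hb hab, degK_Q a b _ hb hab (avP_nonneg _)]
      exact hasDens_parK _ _ (hv b hb))
  rw [degK_comp a b hb hab, degK_Q a b _ hb hab (avP_nonneg _), hl a ha, hl b hb] at hw
  have h1 := miK_par_ne_top hn ν E P h a ha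
  have h2 := miK_par_ne_top hn ν E P h b hb
  rw [← ENNReal.ofReal_toReal h1, ← ENNReal.ofReal_toReal h2, ← ENNReal.ofReal_add (by positivity)
    (hs b hb), ← ENNReal.ofReal_add (by positivity) (hs a ha)] at hw
  exact (ENNReal.ofReal_le_ofReal_iff (by have := hs a ha; positivity)).mp hw

lemma conv_main (hn : 0 < n) (ν : Measure M) [IsProbabilityMeasure ν]
    (E : Kernel M (Fin n → Fin L → ℝ)) [IsMarkovKernel E] (P : ℝ)
    (h : ∀ᵐ x ∂(E ∘ₘ ν), x ∈ totalPow L P n) (a b : Fin L → ℝ) (ha : ∀ l, 0 ≤ a l)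
    (hb : ∀ l, 0 ≤ b l) :
    (miK ν (parK n a ∘ₖ E)).toReal ≤ (miK ν (parK n b ∘ₖ E)).toReal + 
      n * Real.log 2 * ∑ l, Cs (avP (E ∘ₘ ν) l) (a l) (b l) := by
  have h1 := conv_deg hn ν E P h a (fun l => min (a l) (b l)) (fun l => le_min (ha l) (hb l))
    fun l => min_le_left _ _
  have h2 := mi_dpi ν (parK n b ∘ₖ E) (degK n b (fun l => min (a l) (b l)))
  rw [← Kernel.comp_assoc, degK_comp b (fun l => min (a l) (b l)) (fun l => le_min (ha l) (hb l))
    fun l => min_le_right _ _] at h2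
  have h3 := ENNReal.toReal_mono (miK_par_ne_top hn ν E P h b hb) h2
  have h4 : n * Real.log 2 * ∑ l, Cs (avP (E ∘ₘ ν) l) (a l) (b l) =
     ∑ l, n * (Real.log (1 + a l * avP (E ∘ₘ ν) l) / 2) -
      ∑ l, n * (Real.log (1 + min (a l) (b l) * avP (E ∘ₘ ν) l) / 2) := by
    rw [Finset.mul_sum, ← Finset.sum_sub_distrib]
    refine Finset.sum_congr rfl fun l _ => ?_
    have hl2 : 0 < Real.log 2 := Real.log_pos (by norm_num)
    have hp := avP_nonneg (E ∘ₘ ν) l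
    have ha := ha l
    have hb := hb l
    unfold Cs Real.logb
    rcases le_total (a l) (b l) with h5 | h5
    · have : Real.log (1 + a l * avP (E ∘ₘ ν) l) ≤ Real.log (1 + b l * avP (E ∘ₘ ν) l) :=
        Real.log_le_log (by positivity) (by gcongr)
      rw [min_eq_left h5, max_eq_left]
      · ring
      · have := div_le_div_of_nonneg_right this hl2.le
        linarith
    · have : Real.log (1 + b l * avP (E ∘ₘ ν) l) ≤ Real.log (1 + a l * avP (E ∘ₘ ν) l) :=
        Real.log_le_log (by positivity) (by gcongr)
      rw [min_eq_right h5, max_eq_right]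
      · field_simp
      · have := div_le_div_of_nonneg_right this hl2.le
        linarith
  linarith

end Conv
end WT

namespace WT
open InformationTheory

section Unif

/-- uniform law on a finite type -/
def unif (M : Type*) [Fintype M] [MeasurableSpace M] : Measure M :=
  (Fintype.card M : ℝ≥0∞)⁻¹ • Measure.count

variable {M M' Y : Type*} [Fintype M] [MeasurableSpace M] [MeasurableSingletonClass M]
  [Fintype M'] [MeasurableSpace M'] [MeasurableSingletonClass M'] [MeasurableSpace Y]

lemma lintegral_unif (f : M → ℝ≥0∞) :
    ∫⁻ m, f m ∂(unif M) = (Fintype.card M : ℝ≥0∞)⁻¹ * ∑ m, f m := by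
  rw [unif, lintegral_smul_measure, lintegral_count, tsum_fintype, smul_eq_mul]

instance [Nonempty M] : IsProbabilityMeasure (unif M) := by
  constructor
  rw [← lintegral_one, lintegral_unif]
  simp
  exact ENNReal.inv_mul_cancel (by simp) (by simp)

lemma unif_compProd_apply [Nonempty M] (κ : Kernel M Y) [IsMarkovKernel κ] {s : Set (M × Y)}
    (hs : MeasurableSet s) :
    (unif M ⊗ₘ κ) s = (Fintype.card M : ℝ≥0∞)⁻¹ * ∑ m, κ m (Prod.mk m ⁻¹' s) := by
  rw [Measure.compProd_apply hs, lintegral_unif]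

/-- fano-type bound -/
lemma fano [Nonempty M] (κ : Kernel M Y) [IsMarkovKernel κ] (dec : Y → M)
    (hdec : Measurable dec) (ε : ℝ) (hε : 0 < ε) (hε1 : ε ≤ 1)
    (he : ((unif M ⊗ₘ κ) {p | dec p.2 ≠ p.1}).toReal ≤ ε) (hm : miK (unif M) κ ≠ ⊤) :
    (1 - ε) * Real.log (Fintype.card M) - (ε * Real.log (1 / ε) + Real.log (1 + ε)) ≤
      (miK (unif M) κ).toReal := by
  set E : Set (M × Y) := {p | dec p.2 = p.1} with hE
  have hEm : MeasurableSet E := measurableSet_eq_fun (by fun_prop) (by fun_prop)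
  set K : ℝ := (Fintype.card M : ℝ) with hK
  have hK1 : 1 ≤ K := by
    rw [hK]; exact_mod_cast Fintype.card_pos
  have h1 := kl_event _ _ hm hEm (Real.log (1 + K / ε))
  have hP : 1 - ε ≤ (unif M ⊗ₘ κ).real E := by
    have : (unif M ⊗ₘ κ).real Eᶜ ≤ ε := he
    rw [probReal_compl_eq_one_sub hEm] at this
    linarith
  have hQ : ((unif M).prod (κ ∘ₘ unif M)).real E = 1 / K := by
    rw [measureReal_def, ← Measure.prod_swap, Measure.map_apply measurable_swap hEm,
      Measure.prod_apply (measurable_swap hEm)]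
    have : ∀ y : Y, (unif M) (Prod.mk y ⁻¹' (Prod.swap ⁻¹' E)) = (Fintype.card M : ℝ≥0∞)⁻¹ := by
      intro y
      have : (Prod.mk y ⁻¹' (Prod.swap ⁻¹' E)) = {dec y} := by
        ext m; simp [hE, eq_comm]
      rw [this, unif]; simp
    simp only [this]
    simp [hK]
  have hpos : 0 < 1 + K / ε := by positivity
  rw [hQ, Real.exp_log hpos] at h1
  have h2 : 1 + (1 + K / ε - 1) * (1 / K) = (1 + ε) / ε := by field_simp; ring
  rw [h2, Real.log_div (by positivity) hε.ne'] at h1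
  have h3 : Real.log K - Real.log ε ≤ Real.log (1 + K / ε) := by
    rw [← Real.log_div (by positivity) hε.ne']
    exact Real.log_le_log (by positivity) (by linarith)
  have h4 : 0 ≤ Real.log (1 + K / ε) := Real.log_nonneg (by 
    have : 0 ≤ K / ε := by positivity
    linarith)
  have h5 : (1 - ε) * (Real.log K - Real.log ε) ≤
      Real.log (1 + K / ε) * (unif M ⊗ₘ κ).real E := by
    calc _ ≤ (1 - ε) * Real.log (1 + K / ε) := by
          apply mul_le_mul_of_nonneg_left h3; linarith
      _ ≤ _ := by rw [mul_comm]; exact mul_le_mul_of_nonneg_left hP h4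
  rw [one_div, Real.log_inv]
  have h6 : (miK (unif M) κ).toReal = (klDiv (unif M ⊗ₘ κ) ((unif M).prod (κ ∘ₘ unif M))).toReal :=
    rfl
  rw [h6]
  linarith

lemma miBits_eq {X : Type*} [MeasurableSpace X] (μ : Measure X) [IsProbabilityMeasure μ]
    (κ : Kernel X Y) [IsMarkovKernel κ]
    (hm : miK μ κ ≠ ⊤) : miBits (μ ⊗ₘ κ) = (miK μ κ).toReal / Real.log 2 := by
  have hac : μ ⊗ₘ κ ≪ μ.prod (κ ∘ₘ μ) := (klDiv_ne_top_iff.mp hm).1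
  have h1 : (μ ⊗ₘ κ).map Prod.fst = μ := by
    have := Measure.fst_compProd μ κ; exact this
  have h2 : (μ ⊗ₘ κ).map Prod.snd = κ ∘ₘ μ := by
    have := Measure.snd_compProd μ κ; exact this
  rw [miBits, klDivBits, h1, h2, miK, toReal_klDiv_of_measure_eq hac (by simp), ← integral_div]
  rfl

end Unif

section Joint
variable {n L K₁ K₂ : ℕ}

/-- encoder kernel -/
def encK (enc : Fin K₁ × Fin K₂ → Measure (Fin n → Fin L → ℝ)) :
    Kernel (Fin K₁ × Fin K₂) (Fin n → Fin L → ℝ) := Kernel.ofFunOfCountable enc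

lemma encK_apply (enc : Fin K₁ × Fin K₂ → Measure (Fin n → Fin L → ℝ)) (m) :
    encK enc m = enc m := rfl

instance (enc : Fin K₁ × Fin K₂ → Measure (Fin n → Fin L → ℝ))
    [∀ m, IsProbabilityMeasure (enc m)] : IsMarkovKernel (encK enc) :=
  ⟨fun m => by rw [encK_apply]; infer_instance⟩

/-- adds uniform second message -/
def addK (K₁ K₂ : ℕ) : Kernel (Fin K₁) (Fin K₁ × Fin K₂) :=
  Kernel.ofFunOfCountable fun m => (unif (Fin K₂)).map (Prod.mk m)

lemma addK_apply (m : Fin K₁) : addK K₁ K₂ m = (unif (Fin K₂)).map (Prod.mk m) := rfl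

instance [NeZero K₂] : IsMarkovKernel (addK K₁ K₂) :=
  ⟨fun m => by rw [addK_apply]; exact Measure.isProbabilityMeasure_map (by fun_prop)⟩

lemma joint_eq [NeZero K₁] [NeZero K₂] (g : Fin L → ℝ)
    (enc : Fin K₁ × Fin K₂ → Measure (Fin n → Fin L → ℝ)) [∀ m, IsProbabilityMeasure (enc m)] :
    jointLawPar g enc = unif (Fin K₁ × Fin K₂) ⊗ₘ (parK n g ∘ₖ encK enc) := by
  ext s hs
  rw [unif_compProd_apply _ hs, jointLawPar, Measure.smul_apply, Measure.sum_apply _ hs,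
    tsum_fintype, smul_eq_mul]
  congr 1
  · simp
  · refine Finset.sum_congr rfl fun m _ => ?_
    have : (enc m).bind (parOut g) = (parK n g ∘ₖ encK enc) m := by
      rw [Kernel.comp_apply]; rfl
    rw [this, Measure.dirac_prod, Measure.map_apply (by fun_prop) hs]

lemma joint_eq1 [NeZero K₁] [NeZero K₂] (g : Fin L → ℝ)
    (enc : Fin K₁ × Fin K₂ → Measure (Fin n → Fin L → ℝ)) [∀ m, IsProbabilityMeasure (enc m)] :
    (jointLawPar g enc).map (fun p => (p.1.1, p.2)) =
      unif (Fin K₁) ⊗ₘ (parK n g ∘ₖ (encK enc ∘ₖ addK K₁ K₂)) := by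
  ext s hs
  have hf : Measurable (fun p : (Fin K₁ × Fin K₂) × (Fin n → Fin L → ℝ) => (p.1.1, p.2)) := by
    fun_prop
  rw [joint_eq, Measure.map_apply hf hs, unif_compProd_apply _ (hf hs), unif_compProd_apply _ hs,
    Fintype.sum_prod_type]
  simp only [Fintype.card_prod, Fintype.card_fin, Nat.cast_mul]
  rw [ENNReal.mul_inv (by simp) (by simp), mul_assoc, Finset.mul_sum]
  congr 1
  refine Finset.sum_congr rfl fun m _ => ?_
  rw [← Kernel.comp_assoc, Kernel.comp_apply, addK_apply, Measure.bind_apply 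
    (measurable_prodMk_left hs) (Kernel.aemeasurable _), lintegral_map
    (Kernel.measurable_coe _ (measurable_prodMk_left hs)) (by fun_prop), lintegral_unif]
  simp only [Fintype.card_fin]
  rfl

lemma addK_unif [NeZero K₁] [NeZero K₂] : addK K₁ K₂ ∘ₘ unif (Fin K₁) = unif (Fin K₁ × Fin K₂) := by
  ext s hs
  rw [Measure.bind_apply hs (Kernel.aemeasurable _), lintegral_unif]
  simp_rw [addK_apply]
  have hu : unif (Fin K₁ × Fin K₂) s = (Fintype.card (Fin K₁ × Fin K₂) : ℝ≥0∞)⁻¹ *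
      Measure.count s := rfl
  rw [hu]
  simp only [Fintype.card_prod, Fintype.card_fin, Nat.cast_mul]
  rw [ENNReal.mul_inv (by simp) (by simp), mul_assoc]
  congr 1
  rw [← lintegral_indicator_one hs, lintegral_count, tsum_fintype, Fintype.sum_prod_type,
    Finset.mul_sum]
  refine Finset.sum_congr rfl fun m _ => ?_
  rw [← lintegral_indicator_one hs, lintegral_map (measurable_one.indicator hs) (by fun_prop),
    lintegral_unif, Fintype.card_fin]

end Joint
end WT

namespace WT
open InformationTheory

lemma conv_eps (L : ℕ) (a b₁ b₂ : Fin L → ℝ)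
    (P : ℝ) (ha : ∀ l, 0 ≤ a l) (hb₁ : ∀ l, 0 ≤ b₁ l) (hb₂ : ∀ l, 0 ≤ b₂ l)
    (R₁ R₂ : ℝ) (hA : ParAchievable L a b₁ b₂ (totalPow L P) R₁ R₂) (ε : ℝ) (hε : 0 < ε)
    (hε1 : ε ≤ 1) :
    ∃ p : Fin L → ℝ, (∀ l, 0 ≤ p l) ∧ (∑ l, p l) ≤ P ∧
      (1 - ε) * (R₁ - ε) ≤ ε + (ε * Real.log (1 / ε) + Real.log (1 + ε)) / Real.log 2 +
        ∑ l, Cs (p l) (a l) (b₁ l) ∧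
      (1 - ε) * (R₁ + R₂ - 2 * ε) ≤ ε + (ε * Real.log (1 / ε) + Real.log (1 + ε)) / Real.log 2 +
        ∑ l, Cs (p l) (a l) (b₂ l) := by
  obtain ⟨n, hn, K₁, K₂, hK₁, hK₂, hr1, hr2, enc, hpr, hpow, dec, hdec, herr, hl2, hl1⟩ := hA ε hε
  have hn1 : (1 : ℝ) ≤ n := by exact_mod_cast hn
  have : NeZero K₁ := ⟨hK₁.ne'⟩
  have : NeZero K₂ := ⟨hK₂.ne'⟩
  have hlog : 0 < Real.log 2 := Real.log_pos (by norm_num)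
  have hη : 0 ≤ ε * Real.log (1 / ε) + Real.log (1 + ε) := by
    have h1 : 0 ≤ Real.log (1 / ε) := Real.log_nonneg (by rw [le_div_iff₀ hε]; linarith)
    have h2 : 0 ≤ Real.log (1 + ε) := Real.log_nonneg (by linarith)
    positivity
  set μ := encK enc ∘ₘ unif (Fin K₁ × Fin K₂) with hμ
  have hμ1 : (encK enc ∘ₖ addK K₁ K₂) ∘ₘ unif (Fin K₁) = μ := by
    rw [← Measure.comp_assoc, addK_unif]
  have hms : MeasurableSet (totalPow L P n) := by
    unfold totalPow
    exact measurableSet_le (by fun_prop) (by fun_prop)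
  have hae : ∀ᵐ x ∂μ, x ∈ totalPow L P n := by
    rw [ae_iff, hμ]
    have : {x | x ∉ totalPow L P n} = (totalPow L P n)ᶜ := rfl
    rw [this, Measure.bind_apply hms.compl (Kernel.aemeasurable _), lintegral_unif]
    have : ∀ m, encK enc m (totalPow L P n)ᶜ = 0 := fun m => by
      rw [encK_apply, prob_compl_eq_zero_iff hms]; exact hpow m
    simp [this]
  have hae1 : ∀ᵐ x ∂((encK enc ∘ₖ addK K₁ K₂) ∘ₘ unif (Fin K₁)), x ∈ totalPow L P n := by
    rw [hμ1]; exact hae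
  have key : ∀ R δ I I' C K : ℝ, n * (R - δ) ≤ Real.logb 2 K → 
      (1 - ε) * Real.log K - (ε * Real.log (1 / ε) + Real.log (1 + ε)) ≤ I →
      I' / Real.log 2 ≤ n * ε → I ≤ I' + n * Real.log 2 * C →
      (1 - ε) * (R - δ) ≤ ε + (ε * Real.log (1 / ε) + Real.log (1 + ε)) / Real.log 2 + C := by
    intro R δ I I' C K h1 h2 h3 h4
    rw [Real.logb, le_div_iff₀ hlog] at h1
    rw [div_le_iff₀ hlog] at h3
    have h5 := mul_le_mul_of_nonneg_left h1 (sub_nonneg.mpr hε1)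
    set η := ε * Real.log (1 / ε) + Real.log (1 + ε)
    have h6 : (n * Real.log 2) * ((1 - ε) * (R - δ)) ≤ (n * Real.log 2) * (ε + η / Real.log 2 + C) := by
      have h7 : (n * Real.log 2) * (ε + η / Real.log 2 + C) = n * ε * Real.log 2 + n * η + 
        n * Real.log 2 * C := by field_simp
      rw [h7]
      nlinarith
    exact le_of_mul_le_mul_left h6 (by positivity)
  refine ⟨avP μ, avP_nonneg μ, avP_sum hn μ P hae, ?_, ?_⟩
  · have t1 := miK_par_ne_top hn _ _ P hae1 a ha
    have t2 := miK_par_ne_top hn _ _ P hae1 b₁ hb₁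
    rw [joint_eq1, miBits_eq _ _ t2] at hl1
    have h1 := conv_main hn _ _ P hae1 a b₁ ha hb₁
    rw [hμ1] at h1
    have h2 := fano (parK n a ∘ₖ (encK enc ∘ₖ addK K₁ K₂)) (fun y => (dec y).1) (by fun_prop)
      ε hε hε1 (by
        rw [← joint_eq1, Measure.map_apply]
        · refine le_trans (ENNReal.toReal_mono ?_ (measure_mono ?_)) herr
          · rw [joint_eq]; exact measure_ne_top _ _
          · intro p hp h
            exact hp (congrArg Prod.fst h)
        · fun_prop
        · exact (measurableSet_eq_fun (by fun_prop) (by fun_prop)).compl) t1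
    rw [Fintype.card_fin] at h2
    exact key R₁ ε _ _ _ K₁ hr1 h2 hl1 h1
  · have t1 := miK_par_ne_top hn _ _ P hae a ha
    have t2 := miK_par_ne_top hn _ _ P hae b₂ hb₂
    rw [joint_eq, miBits_eq _ _ t2] at hl2
    have h1 := conv_main hn _ _ P hae a b₂ ha hb₂
    rw [joint_eq] at herr
    have h2 := fano (parK n a ∘ₖ (encK enc)) dec hdec ε hε hε1 herr t1
    refine key (R₁ + R₂) (2 * ε) _ _ _ ((K₁ : ℝ) * K₂) ?_ ?_ hl2 h1
    · rw [Real.logb_mul (by positivity) (by positivity)]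
      linarith
    · simpa using h2

lemma Cs_tendsto (a b : ℝ) (ha : 0 ≤ a) (hb : 0 ≤ b) (p : ℝ) (hp : 0 ≤ p) (u : ℕ → ℝ)
    (hu : Filter.Tendsto u Filter.atTop (nhds p)) :
    Filter.Tendsto (fun k => Cs (u k) a b) Filter.atTop (nhds (Cs p a b)) := by
  have : ContinuousAt (fun q => Cs q a b) p := by
    unfold Cs Real.logb
    have h1 : 1 + a * p ≠ 0 := by positivity
    have h2 : 1 + b * p ≠ 0 := by positivity
    fun_prop (disch := assumption)
  exact this.tendsto.comp hu

theorem converse (L : ℕ) (a b₁ b₂ : Fin L → ℝ)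
    (P : ℝ) (ha : ∀ l, 0 ≤ a l) (hb₁ : ∀ l, 0 ≤ b₁ l) (hb₂ : ∀ l, 0 ≤ b₂ l)
    (R₁ R₂ : ℝ) (hA : ParAchievable L a b₁ b₂ (totalPow L P) R₁ R₂) :
    ∃ Palloc : Fin L → ℝ, (∀ l, 0 ≤ Palloc l) ∧ (∑ l, Palloc l) ≤ P ∧
        R₁ ≤ ∑ l, Cs (Palloc l) (a l) (b₁ l) ∧
        R₁ + R₂ ≤ ∑ l, Cs (Palloc l) (a l) (b₂ l) := by
  let e : ℕ → ℝ := fun k => 1 / ((k : ℝ) + 1)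
  have he0 : ∀ k, 0 < e k := fun k => by positivity
  have he1 : ∀ k, e k ≤ 1 := fun k => by
    have : (0:ℝ) ≤ k := by positivity
    simp only [e]; rw [div_le_one (by positivity)]; linarith
  have hel : Filter.Tendsto e Filter.atTop (nhds 0) := tendsto_one_div_add_atTop_nhds_zero_nat
  choose p hp0 hpP hp1 hp2 using fun k => conv_eps L a b₁ b₂ P ha hb₁ hb₂ R₁ R₂ hA (e k) (he0 k) (he1 k)
  have hS : IsCompact (Set.pi Set.univ fun _ : Fin L => Set.Icc (0:ℝ) P) :=
    isCompact_univ_pi fun _ => isCompact_Icc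
  obtain ⟨q, -, φ, hφ, hq⟩ := hS.tendsto_subseq (x := p) (fun k l _ => ⟨hp0 k l, by
    refine le_trans ?_ (hpP k)
    exact Finset.single_le_sum (fun l _ => hp0 k l) (Finset.mem_univ l)⟩)
  have hql : ∀ l, Filter.Tendsto (fun k => p (φ k) l) Filter.atTop (nhds (q l)) := fun l =>
    (tendsto_pi_nhds.mp hq) l
  have hq0 : ∀ l, 0 ≤ q l := fun l => ge_of_tendsto' (hql l) fun k => hp0 _ l
  have heφ : Filter.Tendsto (fun k => e (φ k)) Filter.atTop (nhds 0) := hel.comp hφ.tendsto_atTop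
  have hr : Filter.Tendsto (fun k => e (φ k) + (e (φ k) * Real.log (1 / e (φ k)) + 
      Real.log (1 + e (φ k))) / Real.log 2) Filter.atTop (nhds 0) := by
    have c : ContinuousAt (fun x : ℝ => x + (-(x * Real.log x) + Real.log (1 + x)) / Real.log 2) 0 := by
      have h1 : ContinuousAt (fun x : ℝ => x * Real.log x) 0 := Real.continuous_mul_log.continuousAt
      have h2 : (1 : ℝ) + 0 ≠ 0 := by norm_num
      fun_prop (disch := assumption)
    have := c.tendsto.comp heφ
    simp only [zero_mul, neg_zero, add_zero, Real.log_one, zero_div] at this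
    refine this.congr fun k => ?_
    simp
  refine ⟨q, hq0, ?_, ?_, ?_⟩
  · exact le_of_tendsto' (tendsto_finsetSum _ fun l _ => hql l) fun k => hpP _
  · have l1 : Filter.Tendsto (fun k => (1 - e (φ k)) * (R₁ - e (φ k))) Filter.atTop (nhds R₁) := by
      have := (tendsto_const_nhds (x := (1:ℝ))).sub heφ |>.mul ((tendsto_const_nhds (x := R₁)).sub heφ)
      simpa using this
    have l2 := hr.add (tendsto_finsetSum Finset.univ fun l _ =>
      Cs_tendsto (a l) (b₁ l) (ha l) (hb₁ l) (q l) (hq0 l) _ (hql l))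
    rw [zero_add] at l2
    exact le_of_tendsto_of_tendsto' l1 l2 fun k => hp1 _
  · have l1 : Filter.Tendsto (fun k => (1 - e (φ k)) * (R₁ + R₂ - 2 * e (φ k))) Filter.atTop
        (nhds (R₁ + R₂)) := by
      have := (tendsto_const_nhds (x := (1:ℝ))).sub heφ |>.mul
        ((tendsto_const_nhds (x := R₁ + R₂)).sub (heφ.const_mul 2))
      simpa using this
    have l2 := hr.add (tendsto_finsetSum Finset.univ fun l _ =>
      Cs_tendsto (a l) (b₂ l) (ha l) (hb₂ l) (q l) (hq0 l) _ (hql l))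
    rw [zero_add] at l2
    exact le_of_tendsto_of_tendsto' l1 l2 fun k => hp2 _

end WT

namespace WT
open InformationTheory

section RC
variable {X Y U J : Type*} [MeasurableSpace X] [MeasurableSpace Y] [Fintype U] 

lemma pair_meas (W : Kernel X Y) [IsMarkovKernel W] (T : Set (X × Y)) (hT : MeasurableSet T) :
    Measurable fun p : X × X => W p.1 {y | (p.2, y) ∈ T} := by
  have hs : MeasurableSet {q : (X × X) × Y | (q.1.2, q.2) ∈ T} := by
    have : Measurable fun q : (X × X) × Y => (q.1.2, q.2) := by fun_prop
    exact this hT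
  exact Kernel.measurable_kernel_prodMk_left (κ := W.comap Prod.fst measurable_fst) hs

lemma lint_eval (γ : Measure X) [IsProbabilityMeasure γ] (u : U) (G : X → ℝ≥0∞)
    (hG : Measurable G) :
    ∫⁻ c, G (c u) ∂(Measure.pi fun _ : U => γ) = ∫⁻ x, G x ∂γ := by
  have := (measurePreserving_eval (fun _ : U => γ) u).map_eq
  rw [← this, lintegral_map hG (measurable_pi_apply u), this]

lemma lint_pair (γ : Measure X) [IsProbabilityMeasure γ] {u u' : U} (h : u ≠ u')
    (G : X × X → ℝ≥0∞) (hG : Measurable G) :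
    ∫⁻ c, G (c u, c u') ∂(Measure.pi fun _ : U => γ) = ∫⁻ x, ∫⁻ x', G (x, x') ∂γ ∂γ := by
  have hi : iIndepFun (fun (i : U) (c : U → X) => c i) (Measure.pi fun _ : U => γ) :=
    iIndepFun_pi (X := fun _ x => x) (fun i => aemeasurable_id)
  have h1 := (indepFun_iff_map_prod_eq_prod_map_map (measurable_pi_apply u).aemeasurable
    (measurable_pi_apply u').aemeasurable).mp
    (hi.indepFun h)
  have e1 := (measurePreserving_eval (fun _ : U => γ) u).map_eq
  have e2 := (measurePreserving_eval (fun _ : U => γ) u').map_eq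
  rw [show (fun c : U → X => c u) = Function.eval u from rfl,
    show (fun c : U → X => c u') = Function.eval u' from rfl, e1, e2] at h1
  rw [← lintegral_prod _ hG.aemeasurable, ← h1, lintegral_map hG (by fun_prop)]

lemma rc_exists [Fintype J] [Nonempty U] (γ : Measure X) [IsProbabilityMeasure γ] (S : Set X)
    (hS : ∀ᵐ x ∂γ, x ∈ S) (W : J → Kernel X Y) [∀ j, IsMarkovKernel (W j)]
    (T : J → Set (X × Y)) (hT : ∀ j, MeasurableSet (T j))
    (N : J → U → Finset U) (hN : ∀ j u, u ∉ N j u) (α β : J → ℝ≥0∞) (k : J → ℕ)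
    (hk : ∀ j u, (N j u).card ≤ k j)
    (hα : ∀ j, ∫⁻ x, W j x {y | (x, y) ∈ T j}ᶜ ∂γ ≤ α j)
    (hβ : ∀ j, ∫⁻ x, ∫⁻ x', W j x {y | (x', y) ∈ T j} ∂γ ∂γ ≤ β j) :
    ∃ c : U → X, (∀ u, c u ∈ S) ∧
      ∑ j, ((Fintype.card U : ℝ≥0∞)⁻¹ * ∑ u, (W j (c u) {y | (c u, y) ∈ T j}ᶜ +
        ∑ u' ∈ N j u, W j (c u) {y | (c u', y) ∈ T j})) ≤ ∑ j, (α j + k j * β j) := by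
  set ρ := Measure.pi fun _ : U => γ with hρ
  have hmp : ∀ j, Measurable fun p : X × X => W j p.1 {y | (p.2, y) ∈ T j} := fun j =>
    pair_meas (W j) (T j) (hT j)
  have hm1 : ∀ j, Measurable fun x : X => W j x {y | (x, y) ∈ T j}ᶜ := fun j => by
    have := pair_meas (W j) (T j)ᶜ (hT j).compl
    exact this.comp (by fun_prop : Measurable fun x : X => (x, x))
  have hm1' : ∀ j (u : U), Measurable fun c : U → X => W j (c u) {y | (c u, y) ∈ T j}ᶜ :=
    fun j u => (hm1 j).comp (measurable_pi_apply u)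
  have hm2 : ∀ j (u u' : U), Measurable fun c : U → X => W j (c u) {y | (c u', y) ∈ T j} :=
    fun j u u' => (hmp j).comp (by fun_prop : Measurable fun c : U → X => (c u, c u'))
  have hm4 : ∀ j (u : U), Measurable fun c : U → X => (W j (c u) {y | (c u, y) ∈ T j}ᶜ +
        ∑ u' ∈ N j u, W j (c u) {y | (c u', y) ∈ T j}) := fun j u => (hm1' j u).add 
      (Finset.measurable_sum _ fun u' _ => hm2 j u u')
  have hm3 : ∀ j, Measurable fun c : U → X => ((Fintype.card U : ℝ≥0∞)⁻¹ *
      ∑ u, (W j (c u) {y | (c u, y) ∈ T j}ᶜ +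
        ∑ u' ∈ N j u, W j (c u) {y | (c u', y) ∈ T j})) := by
    intro j
    refine Measurable.const_mul (Finset.measurable_sum _ fun u _ => (hm1' j u).add 
      (Finset.measurable_sum _ fun u' _ => hm2 j u u')) _
  have hnull : ρ {c | ¬ ∀ u, c u ∈ S} = 0 := by
    rw [← ae_iff, Filter.eventually_all]
    intro u
    exact (measurePreserving_eval (fun _ : U => γ) u).quasiMeasurePreserving.ae hS
  obtain ⟨c, hc, hle⟩ := exists_notMem_null_le_lintegral (μ := ρ) (Finset.measurable_sum _ 
    fun j _ => hm3 j).aemeasurable hnull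
  refine ⟨c, by simpa using hc, hle.trans ?_⟩
  rw [lintegral_finsetSum _ fun j _ => hm3 j]
  refine Finset.sum_le_sum fun j _ => ?_
  rw [lintegral_const_mul _ (Finset.measurable_sum _ fun u _ => hm4 j u),
    lintegral_finsetSum _ fun u _ => hm4 j u]
  have hu : ∀ u ∈ (Finset.univ : Finset U), ∫⁻ c, (W j (c u) {y | (c u, y) ∈ T j}ᶜ +
        ∑ u' ∈ N j u, W j (c u) {y | (c u', y) ∈ T j}) ∂ρ ≤ α j + k j * β j := by
    intro u _
    rw [lintegral_add_left (hm1' j u), lintegral_finsetSum _ fun u' _ => hm2 j u u']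
    gcongr
    · rw [hρ, lint_eval γ u _ (hm1 j)]; exact hα j
    · calc _ ≤ ∑ u' ∈ N j u, β j := by
            refine Finset.sum_le_sum fun u' hu' => ?_
            have hne : u ≠ u' := fun h => hN j u (h ▸ hu')
            rw [hρ, lint_pair γ hne (fun p => W j p.1 {y | (p.2, y) ∈ T j}) (hmp j)]
            exact hβ j
        _ ≤ _ := by
            rw [Finset.sum_const, nsmul_eq_mul]
            gcongr
            exact_mod_cast hk j u
  calc _ ≤ (Fintype.card U : ℝ≥0∞)⁻¹ * ∑ u : U, (α j + k j * β j) := by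
        gcongr with u
        exact hu u (Finset.mem_univ u)
    _ = _ := by
        rw [Finset.sum_const, nsmul_eq_mul, ← mul_assoc, Finset.card_univ, 
          ENNReal.inv_mul_cancel (by simp) (by simp), one_mul]

open Classical in
/-- unique selection -/
def thSel [Nonempty U] (f : U → Prop) : U :=
  if h : ∃ u, f u ∧ ∀ u', u' ≠ u → ¬ f u' then h.choose else Classical.arbitrary U

/-- threshold decoder -/
def thDec [Nonempty U] (c : U → X) (T : Set (X × Y)) (y : Y) : U :=
  thSel (fun u => (c u, y) ∈ T)

lemma thDec_meas [Nonempty U] [MeasurableSpace U] (c : U → X) (T : Set (X × Y))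
    (hT : MeasurableSet T) : Measurable (thDec c T) := by
  have h1 : Measurable (fun (y : Y) (u : U) => (c u, y) ∈ T) := by
    refine measurable_pi_lambda _ fun u => ?_
    exact measurableSet_setOfPred.1 (measurable_prodMk_left hT)
  have h2 : Measurable (thSel : (U → Prop) → U) := measurable_of_countable _
  exact h2.comp h1

lemma thDec_err [Nonempty U] [DecidableEq U] (c : U → X) (T : Set (X × Y)) (μ : Measure Y) (u : U) :
    μ {y | thDec c T y ≠ u} ≤ μ {y | (c u, y) ∈ T}ᶜ +
      ∑ u' ∈ Finset.univ.erase u, μ {y | (c u', y) ∈ T} := by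
  refine le_trans ?_ ((measure_union_le _ _).trans (add_le_add_right (measure_biUnion_finset_le _ _) _))
  refine measure_mono fun y hy => ?_
  by_contra hcon
  simp only [Set.mem_union, Set.mem_compl_iff, Set.mem_setOf_eq, Set.mem_iUnion, not_or, not_not,
    not_exists, Finset.mem_erase, Finset.mem_univ, and_true] at hcon
  refine hy ?_
  obtain ⟨h1, h2⟩ := hcon
  have h : ∃ u, ((c u, y) ∈ T) ∧ ∀ u', u' ≠ u → ¬ ((c u', y) ∈ T) := ⟨u, h1, fun u' h => h2 u' h⟩
  have h3 : thDec c T y = h.choose := by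
    unfold thDec thSel; exact dif_pos h
  rw [h3]
  by_contra h4
  exact h2 _ h4 h.choose_spec.1

end RC
end WT

namespace WT
open InformationTheory

section Leak
variable {Wt Z M : Type*} [MeasurableSpace Z] [Fintype Wt] [Nonempty Wt] [MeasurableSpace Wt]
  [MeasurableSingletonClass Wt] [Fintype M] [Nonempty M] 

lemma kl_unif_le (κ : Kernel Wt Z) [IsMarkovKernel κ] (Q : Measure Z) [IsProbabilityMeasure Q]
    (h : HasDens κ Q) : klDiv (κ ∘ₘ unif Wt) Q ≤
      (Fintype.card Wt : ℝ≥0∞)⁻¹ * ∑ w, klDiv (κ w) Q := by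
  rw [← lintegral_unif, mi_base (unif Wt) κ Q h]
  exact le_self_add

lemma comp_unif_apply (κ : Kernel Wt Z) {s : Set Z} (hs : MeasurableSet s) :
    (κ ∘ₘ unif Wt) s = (Fintype.card Wt : ℝ≥0∞)⁻¹ * ∑ w, κ w s := by
  rw [Measure.bind_apply hs (Kernel.aemeasurable _), lintegral_unif]

lemma leak1 [DecidableEq Wt] (κ : Kernel Wt Z) [IsMarkovKernel κ] (Q : Measure Z)
    [IsProbabilityMeasure Q]
    (h : HasDens κ Q) (D : ℝ) (hD0 : 0 ≤ D) (hD : ∀ w, klDiv (κ w) Q ≤ ENNReal.ofReal D) 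
    (T : Wt → Set Z) (hT : ∀ w, MeasurableSet (T w)) (s1 s2 : ℝ) 
    (h1 : s1 = ∑ w, (κ w).real (T w)ᶜ)
    (h2 : s2 = ∑ w, ∑ w' ∈ Finset.univ.erase w, (κ w).real (T w')) :
    klDiv (κ ∘ₘ unif Wt) Q ≠ ⊤ ∧ (klDiv (κ ∘ₘ unif Wt) Q).toReal ≤ 
      D - (1 - (Fintype.card Wt : ℝ)⁻¹ * s1) * Real.log (Fintype.card Wt) + 1 +
        (Fintype.card Wt : ℝ)⁻¹ * s2 := by
  set K : ℝ := (Fintype.card Wt : ℝ) with hK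
  have hK1 : (1 : ℝ) ≤ K := by
    rw [hK]; exact_mod_cast Fintype.card_pos
  have hK0 : 0 < K := by linarith
  have hb := mi_base (unif Wt) κ Q h
  have hle : klDiv (κ ∘ₘ unif Wt) Q + miK (unif Wt) κ ≤ ENNReal.ofReal D := by
    rw [← hb]
    calc _ ≤ ∫⁻ _, ENNReal.ofReal D ∂(unif Wt) := lintegral_mono hD
      _ = _ := by simp
  have ht1 : klDiv (κ ∘ₘ unif Wt) Q ≠ ⊤ := 
    ne_top_of_le_ne_top ENNReal.ofReal_ne_top (le_self_add.trans hle)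
  have ht2 : miK (unif Wt) κ ≠ ⊤ := 
    ne_top_of_le_ne_top ENNReal.ofReal_ne_top (le_add_self.trans hle)
  refine ⟨ht1, ?_⟩
  have hle' : (klDiv (κ ∘ₘ unif Wt) Q).toReal + (miK (unif Wt) κ).toReal ≤ D := by
    rw [← ENNReal.toReal_add ht1 ht2]
    exact ENNReal.toReal_le_of_le_ofReal hD0 hle
  set E : Set (Wt × Z) := {p | p.2 ∈ T p.1} with hE
  have hEm : MeasurableSet E := by
    have : E = ⋃ w, ({w} : Set Wt) ×ˢ T w := by
      ext ⟨w, z⟩; simp [hE]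
    rw [this]
    exact MeasurableSet.iUnion fun w => (measurableSet_singleton w).prod (hT w)
  have hev := kl_event (unif Wt ⊗ₘ κ) ((unif Wt).prod (κ ∘ₘ unif Wt)) ht2 hEm (Real.log K)
  have hp : ∀ w, Prod.mk w ⁻¹' E = T w := fun w => rfl
  have e1 : (unif Wt ⊗ₘ κ).real E = 1 - K⁻¹ * s1 := by
    rw [Measure.real, unif_compProd_apply κ hEm, ENNReal.toReal_mul, ENNReal.toReal_inv,
      ENNReal.toReal_sum (fun w _ => measure_ne_top _ _), h1]
    simp_rw [hp]
    have : ∀ w, (κ w).real (T w)ᶜ = 1 - (κ w (T w)).toReal := fun w => by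
      rw [probReal_compl_eq_one_sub (hT w)]; rfl
    simp_rw [this]
    rw [Finset.sum_sub_distrib]
    simp only [ENNReal.toReal_natCast, Finset.sum_const, Finset.card_univ, nsmul_eq_mul, mul_one]
    rw [← hK]; field_simp; ring
  have e2 : ((unif Wt).prod (κ ∘ₘ unif Wt)).real E ≤ K⁻¹ * (1 + K⁻¹ * s2) := by
    rw [Measure.real, ← Measure.compProd_const, unif_compProd_apply _ hEm]
    simp_rw [Kernel.const_apply, hp, comp_unif_apply κ (hT _)]
    rw [ENNReal.toReal_mul, ENNReal.toReal_inv,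
      ENNReal.toReal_sum (fun w _ => ENNReal.mul_ne_top (by simp) 
        (ENNReal.sum_ne_top.2 fun w _ => measure_ne_top _ _))]
    simp_rw [ENNReal.toReal_mul, ENNReal.toReal_inv, ENNReal.toReal_sum (fun w _ => measure_ne_top _ _)]
    simp only [ENNReal.toReal_natCast]
    rw [← hK, ← Finset.mul_sum, Finset.sum_comm]
    gcongr
    have : ∑ y, ∑ x, (κ y (T x)).toReal ≤ K + s2 := by
      rw [h2]
      have hKs : K = ∑ w : Wt, (1 : ℝ) := by simp [hK]
      rw [hKs, ← Finset.sum_add_distrib]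
      refine Finset.sum_le_sum fun w _ => ?_
      rw [← Finset.add_sum_erase _ _ (Finset.mem_univ w)]
      have : (κ w).real (T w) ≤ 1 := measureReal_le_one
      exact add_le_add_left this _
    calc _ ≤ K⁻¹ * (K + s2) := by gcongr
      _ = _ := by field_simp
  have hs2 : 0 ≤ s2 := by
    rw [h2]; positivity
  have e3 : Real.log (1 + (Real.exp (Real.log K) - 1) * 
      ((unif Wt).prod (κ ∘ₘ unif Wt)).real E) ≤ 1 + K⁻¹ * s2 := by
    rw [Real.exp_log hK0]
    have h0 : 0 ≤ ((unif Wt).prod (κ ∘ₘ unif Wt)).real E := measureReal_nonneg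
    have h5 : (K - 1) * ((unif Wt).prod (κ ∘ₘ unif Wt)).real E ≤ 1 + K⁻¹ * s2 := by
      calc _ ≤ K * (K⁻¹ * (1 + K⁻¹ * s2)) := by
            apply mul_le_mul _ e2 h0 hK0.le
            linarith
        _ = _ := by field_simp
    have h6 : 0 ≤ (K - 1) * ((unif Wt).prod (κ ∘ₘ unif Wt)).real E := 
      mul_nonneg (by linarith) h0
    have := Real.log_le_sub_one_of_pos (x := 1 + (K - 1) * 
      ((unif Wt).prod (κ ∘ₘ unif Wt)).real E) (by linarith)
    linarith
  rw [e1] at hev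
  have : miK (unif Wt) κ = klDiv (unif Wt ⊗ₘ κ) ((unif Wt).prod (κ ∘ₘ unif Wt)) := rfl
  rw [← this] at hev
  linarith

lemma leak_avg [DecidableEq Wt] (κ : M → Kernel Wt Z) [∀ m, IsMarkovKernel (κ m)] (Q : Measure Z)
    [IsProbabilityMeasure Q]
    (h : ∀ m, HasDens (κ m) Q) (D : ℝ) (hD0 : 0 ≤ D)
    (hD : ∀ m w, klDiv (κ m w) Q ≤ ENNReal.ofReal D) 
    (T : M → Wt → Set Z) (hT : ∀ m w, MeasurableSet (T m w)) (e : ℝ) (he0 : 0 ≤ e)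
    (he : ((Fintype.card M : ℝ≥0∞) * Fintype.card Wt)⁻¹ * ∑ m, ∑ w, (κ m w (T m w)ᶜ +
      ∑ w' ∈ Finset.univ.erase w, κ m w (T m w')) ≤ ENNReal.ofReal e) :
    (Fintype.card M : ℝ≥0∞)⁻¹ * ∑ m, klDiv (κ m ∘ₘ unif Wt) Q ≤ ENNReal.ofReal 
      (D - Real.log (Fintype.card Wt) + 1 + e * (Real.log (Fintype.card Wt) + 1)) := by
  set K : ℝ := (Fintype.card Wt : ℝ) with hK
  have hK1 : (1 : ℝ) ≤ K := by
    rw [hK]; exact_mod_cast Fintype.card_pos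
  have hK0 : 0 < K := by linarith
  set K' : ℝ := (Fintype.card M : ℝ) with hK'
  have hK'0 : 0 < K' := by
    rw [hK']; exact_mod_cast Fintype.card_pos
  set s1 : M → ℝ := fun m => ∑ w, (κ m w).real (T m w)ᶜ
  set s2 : M → ℝ := fun m => ∑ w, ∑ w' ∈ Finset.univ.erase w, (κ m w).real (T m w')
  have hl := fun m => leak1 (κ m) Q (h m) D hD0 (hD m) (T m) (hT m) (s1 m) (s2 m) rfl rfl
  have he' := ENNReal.toReal_le_of_le_ofReal he0 he
  rw [ENNReal.toReal_mul, ENNReal.toReal_inv, ENNReal.toReal_mul, ENNReal.toReal_sum (fun m _ => 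
    ENNReal.sum_ne_top.2 fun w _ => ENNReal.add_ne_top.2 ⟨measure_ne_top _ _, 
      ENNReal.sum_ne_top.2 fun w _ => measure_ne_top _ _⟩)] at he'
  have e1 : ∀ m, (∑ w, (κ m w (T m w)ᶜ +
      ∑ w' ∈ Finset.univ.erase w, κ m w (T m w'))).toReal = s1 m + s2 m := by
    intro m
    rw [ENNReal.toReal_sum (fun w _ => ENNReal.add_ne_top.2 ⟨measure_ne_top _ _, 
      ENNReal.sum_ne_top.2 fun w _ => measure_ne_top _ _⟩), ← Finset.sum_add_distrib]
    refine Finset.sum_congr rfl fun w _ => ?_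
    rw [ENNReal.toReal_add (measure_ne_top _ _) (ENNReal.sum_ne_top.2 fun w _ => measure_ne_top _ _),
      ENNReal.toReal_sum (fun w _ => measure_ne_top _ _)]
    rfl
  simp_rw [e1, ENNReal.toReal_natCast] at he'
  rw [← hK, ← hK'] at he'
  have hlog : 0 ≤ Real.log K := Real.log_nonneg hK1
  have hs1 : ∀ m, 0 ≤ s1 m := fun m => by positivity
  have hs2 : ∀ m, 0 ≤ s2 m := fun m => by positivity
  have hfin : (Fintype.card M : ℝ≥0∞)⁻¹ * ∑ m, klDiv (κ m ∘ₘ unif Wt) Q ≠ ⊤ := 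
    ENNReal.mul_ne_top (by simp) (ENNReal.sum_ne_top.2 fun m _ => (hl m).1)
  rw [← ENNReal.ofReal_toReal hfin]
  refine ENNReal.ofReal_le_ofReal ?_
  rw [ENNReal.toReal_mul, ENNReal.toReal_inv, ENNReal.toReal_sum fun m _ => (hl m).1,
    ENNReal.toReal_natCast, ← hK']
  calc K'⁻¹ * ∑ m, (klDiv (κ m ∘ₘ unif Wt) Q).toReal ≤ K'⁻¹ * ∑ m, (D - Real.log K + 1 +
        K⁻¹ * (s1 m + s2 m) * (Real.log K + 1)) := by
        gcongr with m
        refine (hl m).2.trans ?_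
        have := mul_nonneg (inv_nonneg.2 hK0.le) (hs1 m)
        have := mul_nonneg (mul_nonneg (inv_nonneg.2 hK0.le) (hs2 m)) hlog
        nlinarith
    _ = D - Real.log K + 1 + (K' * K)⁻¹ * (∑ m, (s1 m + s2 m)) * (Real.log K + 1) := by
        rw [Finset.sum_add_distrib, ← Finset.sum_mul, ← Finset.mul_sum]
        simp only [Finset.sum_const, Finset.card_univ, nsmul_eq_mul]
        rw [← hK']; field_simp
    _ ≤ _ := by gcongr
end Leak
end WT

namespace WT
open InformationTheory

lemma cheb {E : Type*} [MeasurableSpace E] (μ : Measure E) [IsProbabilityMeasure μ] (f : E → ℝ)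
    (hf : MemLp f 2 μ) (δ : ℝ) (hδ : 0 < δ) (n : ℕ) (hn : 0 < n) :
    (Measure.pi fun _ : Fin n => μ) {x | n * δ ≤ |∑ i, f (x i) - n * ∫ y, f y ∂μ|} ≤
      ENNReal.ofReal (variance f μ / (n * δ ^ 2)) := by
  set X : (Fin n → E) → ℝ := ∑ i, fun ω => f (ω i) with hX
  have hXa : ∀ x, X x = ∑ i, f (x i) := fun x => by simp [hX]
  have hmi : ∀ i : Fin n, MemLp (fun ω : Fin n → E => f (ω i)) 2 (Measure.pi fun _ : Fin n => μ) :=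
    fun i => hf.comp_measurePreserving (measurePreserving_eval (fun _ : Fin n => μ) i)
  have hm : MemLp X 2 (Measure.pi fun _ : Fin n => μ) := memLp_finsetSum' _ fun i _ => hmi i
  have hn' : (0 : ℝ) < n := by exact_mod_cast hn
  have h := meas_ge_le_variance_div_sq hm (c := n * δ) (by positivity)
  have hv := variance_sum_pi (μ := fun _ : Fin n => μ) (X := fun _ => f) (fun _ => hf)
  rw [hX, hv, ← hX] at h
  have hint : ∫ x, X x ∂(Measure.pi fun _ : Fin n => μ) = n * ∫ y, f y ∂μ := by
    simp_rw [hXa]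
    rw [integral_finsetSum _ fun i _ => (hmi i).integrable (by norm_num)]
    simp_rw [integral_comp_eval (μ := fun _ : Fin n => μ) hf.1]
    simp
  rw [hint] at h
  simp_rw [hXa] at h
  refine h.trans (le_of_eq ?_)
  congr 1
  simp only [Finset.sum_const, Finset.card_univ, Fintype.card_fin, nsmul_eq_mul]
  field_simp

lemma cheb_tendsto {E : Type*} [MeasurableSpace E] (μ : Measure E) [IsProbabilityMeasure μ]
    (f : E → ℝ) (hf : MemLp f 2 μ) (δ : ℝ) (hδ : 0 < δ) (e : ℝ) (he : 0 < e) :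
    ∃ N : ℕ, ∀ n : ℕ, N ≤ n → 0 < n ∧ 
    (Measure.pi fun _ : Fin n => μ) {x | n * δ ≤ |∑ i, f (x i) - n * ∫ y, f y ∂μ|} ≤
      ENNReal.ofReal e := by
  obtain ⟨N, hN⟩ := exists_nat_gt (variance f μ / (e * δ ^ 2))
  refine ⟨N + 1, fun n hn => ⟨by omega, (cheb μ f hf δ hδ n (by omega)).trans ?_⟩⟩
  refine ENNReal.ofReal_le_ofReal ?_
  have hn' : (N : ℝ) + 1 ≤ n := by exact_mod_cast hn
  have hn0 : (0 : ℝ) < n := by have : (0:ℝ) ≤ N := Nat.cast_nonneg N; linarith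
  rw [div_lt_iff₀ (by positivity)] at hN
  rw [div_le_iff₀ (by positivity)]
  have : (N : ℝ) * (e * δ ^ 2) ≤ n * (e * δ ^ 2) := by gcongr; linarith
  linarith

/-- n-letter scalar Gaussian channel -/
def gN (n : ℕ) (g : ℝ) : Kernel (Fin n → ℝ) (Fin n → ℝ) := piK fun _ : Fin n => gK g

instance (n : ℕ) (g : ℝ) : IsMarkovKernel (gN n g) := by unfold gN; infer_instance

lemma gN_apply (n : ℕ) (g : ℝ) (x : Fin n → ℝ) : gN n g x = Measure.pi fun i => gK g (x i) := rfl

/-- reference output law -/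
def qN (n : ℕ) (v : ℝ) : Measure (Fin n → ℝ) := Measure.pi fun _ : Fin n => gaussianReal 0 v.toNNReal

instance (n : ℕ) (v : ℝ) : IsProbabilityMeasure (qN n v) := by unfold qN; infer_instance

lemma hasDens_gN (n : ℕ) (g v : ℝ) (hv : 0 < v) : HasDens (gN n g) (qN n v) :=
  hasDens_piK _ _ fun _ => hasDens_gK g _ (by simpa using hv)

/-- information density -/
def idn (g v : ℝ) (p : ℝ × ℝ) : ℝ := 
  Real.log v / 2 - (p.2 - √g * p.1) ^ 2 / 2 + p.2 ^ 2 / (2 * v)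

lemma idn_meas (g v : ℝ) : Measurable (idn g v) := by unfold idn; fun_prop

lemma gN_dens (n : ℕ) (g v : ℝ) (hv : 0 < v) (x : Fin n → ℝ) :
    gN n g x = (qN n v).withDensity (fun y => ENNReal.ofReal (Real.exp (∑ i, idn g v (x i, y i)))) := by
  have h1 : ∀ i : Fin n, gK g (x i) = (gaussianReal 0 v.toNNReal).withDensity 
      (fun y => ENNReal.ofReal (Real.exp (idn g v (x i, y)))) := fun i => by
    rw [gK_apply, gauss_density _ v.toNNReal (by simpa using hv)]
    unfold idn
    simp only [Real.coe_toNNReal v hv.le]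
  rw [gN_apply]
  have : ∀ i : Fin n, SigmaFinite ((gaussianReal 0 v.toNNReal).withDensity 
      (fun y => ENNReal.ofReal (Real.exp (idn g v (x i, y))))) := fun i => by
    rw [← h1]; infer_instance
  simp_rw [h1]
  rw [pi_withDensity (fun _ : Fin n => gaussianReal 0 v.toNNReal) 
    (fun i y => ENNReal.ofReal (Real.exp (idn g v (x i, y)))) 
    (fun i => by have := idn_meas g v; fun_prop)]
  unfold qN
  congr 1
  ext y
  rw [Real.exp_sum, ENNReal.ofReal_prod_of_nonneg fun i _ => (Real.exp_pos _).le]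

lemma kl_gN (n : ℕ) (g P : ℝ) (hg : 0 ≤ g) (hP : 0 ≤ P) (x : Fin n → ℝ)
    (hx : ∑ i, x i ^ 2 ≤ n * P) :
    klDiv (gN n g x) (qN n (1 + g * P)) ≤ ENNReal.ofReal (n * (Real.log (1 + g * P) / 2)) := by
  have hv : 0 < 1 + g * P := by positivity
  rw [gN_apply, qN, kl_pi]
  have h1 : ∀ i, klDiv (gK g (x i)) (gaussianReal 0 (1 + g * P).toNNReal) = ENNReal.ofReal 
      (Real.log (1 + g * P) / 2 + (1 + g * x i ^ 2) / (2 * (1 + g * P)) - 1 / 2) := fun i => by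
    rw [gK_apply, gauss_kl _ _ (by simpa using hv), Real.coe_toNNReal _ hv.le, mul_pow, 
      Real.sq_sqrt hg]
  simp_rw [h1]
  rw [← ENNReal.ofReal_sum_of_nonneg]
  · refine ENNReal.ofReal_le_ofReal ?_
    simp_rw [add_sub_assoc]
    rw [Finset.sum_add_distrib, Finset.sum_sub_distrib]
    simp only [← Finset.sum_div]
    rw [Finset.sum_add_distrib, ← Finset.mul_sum]
    simp only [Finset.sum_const, Finset.card_univ, Fintype.card_fin, nsmul_eq_mul]
    have : (n * 1 + g * ∑ i, x i ^ 2) / (2 * (1 + g * P)) ≤ n * (1 / 2) := by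
      rw [div_le_iff₀ (by positivity)]
      nlinarith
    linarith
  · intro i _
    have h2 : 0 < (1 + g * x i ^ 2) / (1 + g * P) := by positivity
    have h3 := Real.one_sub_inv_le_log_of_pos hv
    have h4 : (1 + g * P)⁻¹ ≤ (1 + g * x i ^ 2) / (1 + g * P) := by
      rw [inv_eq_one_div]; gcongr; nlinarith [mul_nonneg hg (sq_nonneg (x i))]
    have h5 : (1 + g * x i ^ 2) / (2 * (1 + g * P)) = (1 + g * x i ^ 2) / (1 + g * P) / 2 := by
      field_simp
    rw [h5]; linarith
end WT

namespace WT
open InformationTheory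

/-- typical set -/
def TN (n : ℕ) (g P ε : ℝ) : Set ((Fin n → ℝ) × (Fin n → ℝ)) :=
  {p | n * (Real.log (1 + g * P) / 2 - ε) < ∑ i, idn g (1 + g * P) (p.1 i, p.2 i)}

lemma TN_meas (n : ℕ) (g P ε : ℝ) : MeasurableSet (TN n g P ε) := by
  unfold TN
  have := idn_meas g (1 + g * P)
  exact measurableSet_lt measurable_const (by fun_prop)

lemma qN_bind (n : ℕ) (g P : ℝ) (hg : 0 ≤ g) (hP : 0 ≤ P) :
    (qN n P).bind (gN n g) = qN n (1 + g * P) := by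
  unfold qN gN
  rw [pi_bind]
  simp_rw [gauss_bind_gK g P hg hP]

lemma beta_bound (n : ℕ) (g P ε : ℝ) (hg : 0 ≤ g) (hP : 0 ≤ P) :
    ∫⁻ x, ∫⁻ x', gN n g x {y | (x', y) ∈ TN n g P ε} ∂(qN n P) ∂(qN n P) ≤
      ENNReal.ofReal (Real.exp (-(n * (Real.log (1 + g * P) / 2 - ε)))) := by
  have hv : 0 < 1 + g * P := by positivity
  rw [lintegral_lintegral_swap (pair_meas (gN n g) _ (TN_meas n g P ε)).aemeasurable]
  set τ : ℝ := n * (Real.log (1 + g * P) / 2 - ε) with hτ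
  have hin : ∀ x', ∫⁻ x, gN n g x {y | (x', y) ∈ TN n g P ε} ∂(qN n P) ≤ 
      ENNReal.ofReal (Real.exp (-τ)) := by
    intro x'
    have hms : MeasurableSet {y | (x', y) ∈ TN n g P ε} := measurable_prodMk_left (TN_meas n g P ε)
    rw [← Measure.bind_apply hms (gN n g).aemeasurable, qN_bind n g P hg hP]
    have h1 : gN n g x' {y | (x', y) ∈ TN n g P ε} ≤ 1 := prob_le_one
    rw [gN_dens n g (1 + g * P) hv x', withDensity_apply _ hms] at h1
    have h2 : ENNReal.ofReal (Real.exp τ) * qN n (1 + g * P) {y | (x', y) ∈ TN n g P ε} ≤ 1 := by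
      refine le_trans ?_ h1
      rw [← setLIntegral_const]
      refine setLIntegral_mono' hms fun y hy => ?_
      refine ENNReal.ofReal_le_ofReal (Real.exp_le_exp.2 ?_)
      have : τ < ∑ i, idn g (1 + g * P) (x' i, y i) := hy
      exact this.le
    rw [Real.exp_neg, ENNReal.ofReal_inv_of_pos (Real.exp_pos τ)]
    rw [ENNReal.le_inv_iff_mul_le, mul_comm]
    exact h2
  calc _ ≤ ∫⁻ _, ENNReal.ofReal (Real.exp (-τ)) ∂(qN n P) := lintegral_mono hin
    _ = _ := by simp

lemma memLp_sq (v : NNReal) : MemLp (fun y : ℝ => y ^ 2) 2 (gaussianReal 0 v) := by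
  rw [memLp_two_iff_integrable_sq (by fun_prop)]
  have h := (memLp_id_gaussianReal (μ := 0) (v := v) 4).integrable_norm_pow (p := 4) (by norm_num)
  refine h.congr (Filter.Eventually.of_forall fun y => ?_)
  simp only [id, Real.norm_eq_abs]
  rw [← pow_mul, Even.pow_abs (by decide)]

/-- joint law, single letter -/
def jN (g P : ℝ) : Measure (ℝ × ℝ) := (gaussianReal 0 P.toNNReal) ⊗ₘ (gK g)

instance (g P : ℝ) : IsProbabilityMeasure (jN g P) := by unfold jN; infer_instance

lemma jN_snd (g P : ℝ) (hg : 0 ≤ g) (hP : 0 ≤ P) :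
    MeasurePreserving (fun p : ℝ × ℝ => p.2) (jN g P) (gaussianReal 0 (1 + g * P).toNNReal) := by
  refine ⟨measurable_snd, ?_⟩
  have := Measure.snd_compProd (gaussianReal 0 P.toNNReal) (gK g)
  rw [gauss_bind_gK g P hg hP] at this
  exact this

lemma jN_noise (g P : ℝ) :
    MeasurePreserving (fun p : ℝ × ℝ => p.2 - √g * p.1) (jN g P) (gaussianReal 0 1) := by
  have hm : Measurable (fun p : ℝ × ℝ => p.2 - √g * p.1) := by fun_prop
  refine ⟨hm, ?_⟩
  ext s hs
  rw [Measure.map_apply hm hs, jN, Measure.compProd_apply (hm hs)]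
  have : ∀ x : ℝ, gK g x (Prod.mk x ⁻¹' ((fun p : ℝ × ℝ => p.2 - √g * p.1) ⁻¹' s)) = 
      gaussianReal 0 1 s := by
    intro x
    have h := gaussianReal_map_sub_const (μ := √g * x) (v := 1) (√g * x)
    rw [sub_self] at h
    rw [← h, Measure.map_apply (by fun_prop) hs, gK_apply]
    rfl
  simp_rw [this]
  simp

lemma idn_memLp (g P : ℝ) (hg : 0 ≤ g) (hP : 0 ≤ P) : MemLp (idn g (1 + g * P)) 2 (jN g P) := by
  have h1 : MemLp (fun p : ℝ × ℝ => p.2 ^ 2) 2 (jN g P) := 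
    (memLp_sq _).comp_measurePreserving (jN_snd g P hg hP)
  have h2 : MemLp (fun p : ℝ × ℝ => (p.2 - √g * p.1) ^ 2) 2 (jN g P) := 
    (memLp_sq 1).comp_measurePreserving (jN_noise g P)
  have h3 := ((memLp_const (μ := jN g P) (p := 2) (Real.log (1 + g * P) / 2)).sub 
    (h2.const_mul (1 / 2))).add (h1.const_mul (1 / (2 * (1 + g * P))))
  convert h3 using 1
  ext p
  simp only [idn, Pi.add_apply, Pi.sub_apply]
  ring

lemma idn_mean (g P : ℝ) (hg : 0 ≤ g) (hP : 0 ≤ P) : 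
    ∫ p, idn g (1 + g * P) p ∂(jN g P) = Real.log (1 + g * P) / 2 := by
  have hv : 0 < 1 + g * P := by positivity
  have h1 : MemLp (fun p : ℝ × ℝ => p.2 ^ 2) 2 (jN g P) := 
    (memLp_sq _).comp_measurePreserving (jN_snd g P hg hP)
  have h2 : MemLp (fun p : ℝ × ℝ => (p.2 - √g * p.1) ^ 2) 2 (jN g P) := 
    (memLp_sq 1).comp_measurePreserving (jN_noise g P)
  have h1i := h1.integrable (by norm_num)
  have h2i := h2.integrable (by norm_num)
  have e1 : ∫ p : ℝ × ℝ, p.2 ^ 2 ∂(jN g P) = 1 + g * P := by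
    have := integral_sq_gauss 0 (1 + g * P).toNNReal
    rw [← (jN_snd g P hg hP).map_eq, integral_map (by fun_prop) (by fun_prop)] at this
    rw [this, Real.coe_toNNReal _ hv.le]; ring
  have e2 : ∫ p : ℝ × ℝ, (p.2 - √g * p.1) ^ 2 ∂(jN g P) = 1 := by
    have := integral_sq_gauss 0 1
    rw [← (jN_noise g P).map_eq, integral_map (by fun_prop) (by fun_prop)] at this
    rw [this]; simp
  have e3 : ∀ p, idn g (1 + g * P) p = Real.log (1 + g * P) / 2 + 
      (p.2 ^ 2 * (1 / (2 * (1 + g * P))) - (p.2 - √g * p.1) ^ 2 * (1 / 2)) := fun p => by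
    simp only [idn]; ring
  simp_rw [e3]
  have h1i' : Integrable (fun p : ℝ × ℝ => p.2 ^ 2 * (1 / (2 * (1 + g * P)))) (jN g P) := 
    h1i.mul_const _
  have h2i' : Integrable (fun p : ℝ × ℝ => (p.2 - √g * p.1) ^ 2 * (1 / 2)) (jN g P) := 
    h2i.mul_const _
  have h3i' : Integrable (fun p : ℝ × ℝ => p.2 ^ 2 * (1 / (2 * (1 + g * P))) - 
    (p.2 - √g * p.1) ^ 2 * (1 / 2)) (jN g P) := h1i'.sub h2i'
  rw [integral_add (integrable_const _) h3i', integral_sub h1i' h2i', integral_mul_const,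
    integral_mul_const, e1, e2]
  simp
  field_simp
  ring

lemma joint_pi (n : ℕ) (g P : ℝ) {s : Set (Fin n → ℝ × ℝ)} (hs : MeasurableSet s) :
    ∫⁻ x, gN n g x {y | (fun i => (x i, y i)) ∈ s} ∂(qN n P) = 
      (Measure.pi fun _ : Fin n => jN g P) s := by
  have h1 : (gaussianReal 0 P.toNNReal).bind (Kernel.id ×ₖ gK g) = jN g P := by
    rw [jN, Measure.compProd_eq_comp_prod]
  have h2 := pi_bind (fun _ : Fin n => gaussianReal 0 P.toNNReal) (fun _ => Kernel.id ×ₖ gK g)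
  simp_rw [h1] at h2
  rw [← h2, Measure.bind_apply hs (Kernel.aemeasurable _)]
  unfold qN
  refine lintegral_congr fun x => ?_
  have h3 : piK (fun _ : Fin n => Kernel.id ×ₖ gK g) x = (gN n g x).map 
      (fun y i => (x i, y i)) := by
    rw [gN_apply, piK_apply]
    have : ∀ i : Fin n, IsProbabilityMeasure ((gK g (x i)).map (Prod.mk (x i))) := fun i => 
      Measure.isProbabilityMeasure_map (by fun_prop)
    rw [Measure.pi_map_pi (f := fun i y => (x i, y)) fun i => by fun_prop]
    congr 1
    ext1 i
    rw [Kernel.prod_apply, Kernel.id_apply, Measure.dirac_prod]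
  rw [h3, Measure.map_apply (by fun_prop) hs]
  rfl

lemma alpha_bound (g P ε e : ℝ) (hg : 0 ≤ g) (hP : 0 ≤ P) (hε : 0 < ε) (he : 0 < e) :
    ∃ N : ℕ, ∀ n : ℕ, N ≤ n → 
      ∫⁻ x, gN n g x {y | (x, y) ∈ TN n g P ε}ᶜ ∂(qN n P) ≤ ENNReal.ofReal e := by
  obtain ⟨N, hN⟩ := cheb_tendsto (jN g P) _ (idn_memLp g P hg hP) ε hε e he
  refine ⟨N, fun n hn => le_trans ?_ (hN n hn).2⟩
  have hm : Measurable (fun p : Fin n → ℝ × ℝ => ∑ i, idn g (1 + g * P) (p i)) := by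
    have := idn_meas g (1 + g * P)
    fun_prop
  have hs : MeasurableSet {p : Fin n → ℝ × ℝ | ∑ i, idn g (1 + g * P) (p i) ≤
      n * (Real.log (1 + g * P) / 2 - ε)} := measurableSet_le hm measurable_const
  have := joint_pi n g P hs
  have h2 : ∀ x : Fin n → ℝ, {y | (x, y) ∈ TN n g P ε}ᶜ = {y | (fun i => (x i, y i)) ∈ 
    {p : Fin n → ℝ × ℝ | ∑ i, idn g (1 + g * P) (p i) ≤ n * (Real.log (1 + g * P) / 2 - ε)}} := by
    intro x; ext y; simp [TN]
  simp_rw [h2, this]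
  refine measure_mono fun p hp => ?_
  simp only [Set.mem_setOf_eq] at hp ⊢
  rw [idn_mean g P hg hP, abs_of_nonpos]
  · linarith
  · have : 0 ≤ n * ε := by positivity
    linarith

lemma pow_ok (P' P : ℝ) (h0 : 0 ≤ P') (h : P' < P ∨ (P' = 0 ∧ P = 0)) :
    ∃ N : ℕ, ∀ n : ℕ, N ≤ n → (1 / 2 : ℝ≥0∞) ≤ qN n P' {x | ∑ i, x i ^ 2 ≤ n * P} := by
  have hms : ∀ n : ℕ, MeasurableSet {x : Fin n → ℝ | ∑ i, x i ^ 2 ≤ n * P} := fun n =>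
    measurableSet_le (by fun_prop) measurable_const
  rcases h with h | ⟨h1, h2⟩
  · obtain ⟨N, hN⟩ := cheb_tendsto (gaussianReal 0 P'.toNNReal) _ (memLp_sq _) (P - P') 
      (by linarith) (1 / 2) (by norm_num)
    refine ⟨N, fun n hn => ?_⟩
    have h1 := (hN n hn).2
    have h2 : qN n P' {x | ∑ i, x i ^ 2 ≤ n * P}ᶜ ≤ ENNReal.ofReal (1 / 2) := by
      refine le_trans (measure_mono fun x hx => ?_) h1
      simp only [Set.mem_compl_iff, Set.mem_setOf_eq, not_le] at hx ⊢
      rw [integral_sq_gauss, Real.coe_toNNReal _ h0]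
      refine le_trans ?_ (le_abs_self _)
      simp only [ne_eq, OfNat.ofNat_ne_zero, not_false_eq_true, zero_pow, add_zero]
      linarith
    rw [prob_compl_eq_one_sub (hms n)] at h2
    have h3 : (1 : ℝ≥0∞) ≤ ENNReal.ofReal (1 / 2) + qN n P' {x | ∑ i, x i ^ 2 ≤ n * P} := 
      tsub_le_iff_right.1 h2
    have h4 : ENNReal.ofReal (1 / 2) = 1 / 2 := by
      rw [ENNReal.ofReal_div_of_pos (by norm_num)]; simp
    rw [h4] at h3
    have h5 : (1 / 2 : ℝ≥0∞) + 1 / 2 = 1 := by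
      simp [ENNReal.inv_two_add_inv_two]
    have h6 : (1 / 2 : ℝ≥0∞) + 1 / 2 ≤ 1 / 2 + qN n P' {x | ∑ i, x i ^ 2 ≤ n * P} := h5.le.trans h3
    exact (ENNReal.add_le_add_iff_left (by simp)).1 h6
  · subst h1 h2
    have hms' := hms
    refine ⟨0, fun n _ => ?_⟩
    have : qN n 0 {x | ∑ i, x i ^ 2 ≤ n * (0 : ℝ)} = 1 := by
      have h1 : ∀ i : Fin n, ∀ᵐ x ∂(qN n 0), x i = 0 := fun i => by
        have h2 : ∀ᵐ y ∂(gaussianReal 0 (0 : ℝ).toNNReal), y = 0 := by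
          rw [Real.toNNReal_zero, gaussianReal_zero_var]
          rw [ae_dirac_eq]
          rfl
        exact (measurePreserving_eval (fun _ : Fin n => gaussianReal 0 (0 : ℝ).toNNReal) 
          i).quasiMeasurePreserving.ae h2
      rw [← mem_ae_iff_prob_eq_one (hms' n)]
      filter_upwards [Filter.eventually_all.2 h1] with x hx
      simp [hx]
    rw [this]; simp
end WT

namespace WT
open InformationTheory

lemma lint_cond_le {X : Type*} [MeasurableSpace X] (μ : Measure X) [IsProbabilityMeasure μ] 
    (S : Set X) (h : (1 / 2 : ℝ≥0∞) ≤ μ S) (f : X → ℝ≥0∞) :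
    ∫⁻ x, f x ∂(ProbabilityTheory.cond μ S) ≤ 2 * ∫⁻ x, f x ∂μ := by
  rw [ProbabilityTheory.cond, lintegral_smul_measure, smul_eq_mul]
  gcongr
  · rw [ENNReal.inv_le_iff_inv_le]
    simpa using h
  · exact Measure.restrict_le_self

/-- triple of gains -/
def g3 (a b₁ b₂ : ℝ) : Fin 3 → ℝ := ![a, b₁, b₂]

section Core
variable {A B D : Type} [Fintype A] [Fintype B] [Fintype D] [DecidableEq A] [DecidableEq B]
  [DecidableEq D] [Nonempty A] [Nonempty B] [Nonempty D]

/-- neighbours -/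
def nb : Fin 3 → A × (B × D) → Finset (A × (B × D)) := 
  ![fun u => Finset.univ.erase u, 
    fun u => (Finset.univ.erase u.2).map ⟨fun w => (u.1, w), fun _ _ h => (Prod.mk.inj h).2⟩,
    fun u => (Finset.univ.erase u.2.2).map ⟨fun d => (u.1, (u.2.1, d)), 
      fun _ _ h => (Prod.mk.inj (Prod.mk.inj h).2).2⟩]

lemma nb_not_mem (j : Fin 3) (u : A × (B × D)) : u ∉ nb j u := by
  fin_cases j
  · simp [nb]
  · simp only [nb]
    intro h
    obtain ⟨w, hw, he⟩ := Finset.mem_map.1 h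
    exact (Finset.mem_erase.1 hw).1 (congrArg Prod.snd he)
  · simp only [nb]
    intro h
    obtain ⟨w, hw, he⟩ := Finset.mem_map.1 h
    exact (Finset.mem_erase.1 hw).1 (congrArg (fun p => p.2.2) he)

lemma nb_card (j : Fin 3) (u : A × (B × D)) : ((nb j u).card : ℝ) = 
    (![Fintype.card A * (Fintype.card B * Fintype.card D), Fintype.card B * Fintype.card D, 
      Fintype.card D] j : ℕ) - 1 := by
  have hA : 0 < Fintype.card A := Fintype.card_pos
  have hB : 0 < Fintype.card B := Fintype.card_pos
  have hD : 0 < Fintype.card D := Fintype.card_pos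
  fin_cases j 
  · simp [nb, Finset.card_erase_of_mem]
    rw [Nat.cast_sub (Nat.one_le_iff_ne_zero.2 (by positivity))]; simp
  · simp [nb, Finset.card_erase_of_mem]
    rw [Nat.cast_sub (Nat.one_le_iff_ne_zero.2 (by positivity))]; simp
  · simp [nb, Finset.card_erase_of_mem]
    rw [Nat.cast_sub (Nat.one_le_iff_ne_zero.2 (by positivity))]; simp

lemma core0 (g : Fin 3 → ℝ) (P' P ε e : ℝ) (hg : ∀ j, 0 ≤ g j) (hP' : 0 ≤ P')
    (hPP : P' < P ∨ (P' = 0 ∧ P = 0)) (hε : 0 < ε) (he : 0 < e) :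
    ∃ N : ℕ, ∀ n : ℕ, N ≤ n → ∀ (A B D : Type) [Fintype A] [Fintype B] [Fintype D] [DecidableEq A]
      [DecidableEq B] [DecidableEq D] [Nonempty A] [Nonempty B] [Nonempty D],
      (∀ j, ((![Fintype.card A * (Fintype.card B * Fintype.card D), 
        Fintype.card B * Fintype.card D, Fintype.card D] j : ℕ) : ℝ) - 1 ≤
          Real.exp (n * (Real.log (1 + g j * P') / 2 - 2 * ε))) →
      ∃ c : A × (B × D) → (Fin n → ℝ), (∀ u, ∑ i, c u i ^ 2 ≤ n * P) ∧ ∀ j, 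
        (Fintype.card (A × (B × D)) : ℝ≥0∞)⁻¹ * ∑ u, (gN n (g j) (c u) 
          {y | (c u, y) ∈ TN n (g j) P' ε}ᶜ + ∑ u' ∈ nb j u, gN n (g j) (c u) 
            {y | (c u', y) ∈ TN n (g j) P' ε}) ≤ ENNReal.ofReal e := by
  choose N1 hN1 using fun j => alpha_bound (g j) P' ε (e / 12) (hg j) hP' hε (by positivity)
  obtain ⟨N2, hN2⟩ := pow_ok P' P hP' hPP
  obtain ⟨N3, hN3⟩ := exists_nat_gt (24 / e / ε)
  refine ⟨(∑ j, N1 j) + N2 + N3, fun n hn A B D _ _ _ _ _ _ _ _ _ hsz => ?_⟩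
  have hn1 : ∀ j, N1 j ≤ n := fun j => by
    have := Finset.single_le_sum (f := N1) (fun j _ => Nat.zero_le _) (Finset.mem_univ j)
    omega
  have hn3 : 24 / e / ε < n := hN3.trans_le (by exact_mod_cast (by omega : N3 ≤ n))
  set S : Set (Fin n → ℝ) := {x | ∑ i, x i ^ 2 ≤ n * P} with hS
  have hSm : MeasurableSet S := measurableSet_le (by fun_prop) measurable_const
  have hS2 : (1 / 2 : ℝ≥0∞) ≤ qN n P' S := hN2 n (by omega)
  set γ := ProbabilityTheory.cond (qN n P') S with hγ
  have : IsProbabilityMeasure γ := cond_isProbabilityMeasure (by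
    intro h; rw [h] at hS2; simp at hS2)
  have hγS : ∀ᵐ x ∂γ, x ∈ S := by
    have : ∀ᵐ x ∂(qN n P').restrict S, x ∈ S := ae_restrict_mem hSm
    exact Measure.ae_smul_measure this _
  have hα : ∀ j, ∫⁻ x, gN n (g j) x {y | (x, y) ∈ TN n (g j) P' ε}ᶜ ∂γ ≤ 
      ENNReal.ofReal (e / 6) := fun j => by
    refine (lint_cond_le _ S hS2 _).trans ?_
    rw [show e / 6 = 2 * (e / 12) by ring, ENNReal.ofReal_mul (by norm_num)]
    simp only [ENNReal.ofReal_ofNat]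
    gcongr
    exact hN1 j n (hn1 j)
  have hβ : ∀ j, ∫⁻ x, ∫⁻ x', gN n (g j) x {y | (x', y) ∈ TN n (g j) P' ε} ∂γ ∂γ ≤ 
      ENNReal.ofReal (4 * Real.exp (-(n * (Real.log (1 + g j * P') / 2 - ε)))) := fun j => by
    refine (lint_cond_le _ S hS2 _).trans ?_
    calc _ ≤ 2 * ∫⁻ x, 2 * ∫⁻ x', gN n (g j) x {y | (x', y) ∈ TN n (g j) P' ε} ∂(qN n P') ∂(qN n P') := by
          gcongr with x
          exact lint_cond_le _ S hS2 _
      _ = 4 * ∫⁻ x, ∫⁻ x', gN n (g j) x {y | (x', y) ∈ TN n (g j) P' ε} ∂(qN n P') ∂(qN n P') := by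
          rw [lintegral_const_mul' _ _ (by norm_num), ← mul_assoc]; norm_num
      _ ≤ _ := by
          rw [ENNReal.ofReal_mul (by norm_num)]
          simp only [ENNReal.ofReal_ofNat]
          gcongr
          exact beta_bound n (g j) P' ε (hg j) hP'
  set k : Fin 3 → ℕ := fun j => (![Fintype.card A * (Fintype.card B * Fintype.card D), 
        Fintype.card B * Fintype.card D, Fintype.card D] j) - 1 with hk
  have hkc : ∀ j (u : A × (B × D)), (nb j u).card = k j := fun j u => by
    have h := nb_card j u
    have h1 : 1 ≤ ![Fintype.card A * (Fintype.card B * Fintype.card D), 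
        Fintype.card B * Fintype.card D, Fintype.card D] j := by
      have : (0 : ℝ) ≤ (nb j u).card := Nat.cast_nonneg _
      rw [h] at this
      have h2 : (1 : ℝ) ≤ (![Fintype.card A * (Fintype.card B * Fintype.card D), 
        Fintype.card B * Fintype.card D, Fintype.card D] j : ℕ) := by linarith
      exact_mod_cast h2
    have h3 : ((nb j u).card : ℝ) = (k j : ℕ) := by
      rw [h, hk, Nat.cast_sub h1]; simp
    exact_mod_cast h3
  obtain ⟨u0⟩ : Nonempty (A × (B × D)) := inferInstance
  obtain ⟨c, hc, hle⟩ := rc_exists (U := A × (B × D)) γ S hγS (fun j => gN n (g j)) 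
    (fun j => TN n (g j) P' ε) (fun j => TN_meas _ _ _ _) nb nb_not_mem _ _ k 
    (fun j u => (hkc j u).le) hα hβ
  refine ⟨c, hc, fun j => ?_⟩
  refine le_trans (Finset.single_le_sum (f := fun j => (Fintype.card (A × (B × D)) : ℝ≥0∞)⁻¹ * 
    ∑ u, (gN n (g j) (c u) {y | (c u, y) ∈ TN n (g j) P' ε}ᶜ + ∑ u' ∈ nb j u, gN n (g j) (c u) 
            {y | (c u', y) ∈ TN n (g j) P' ε})) (fun _ _ => zero_le) (Finset.mem_univ j)) 
    (hle.trans ?_)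
  have hterm : ∀ j, ENNReal.ofReal (e / 6) + (k j : ℝ≥0∞) * ENNReal.ofReal (4 * 
      Real.exp (-(n * (Real.log (1 + g j * P') / 2 - ε)))) ≤ ENNReal.ofReal (e / 3) := by
    intro j
    rw [← ENNReal.ofReal_natCast, ← ENNReal.ofReal_mul (Nat.cast_nonneg _), 
      ← ENNReal.ofReal_add (by positivity) (by positivity)]
    refine ENNReal.ofReal_le_ofReal ?_
    have h1 : (k j : ℝ) ≤ Real.exp (n * (Real.log (1 + g j * P') / 2 - 2 * ε)) := by
      rw [← hkc j u0, nb_card]; exact hsz j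
    have h2 : (k j : ℝ) * (4 * Real.exp (-(n * (Real.log (1 + g j * P') / 2 - ε)))) ≤ 
        4 * Real.exp (-(n * ε)) := by
      calc _ ≤ Real.exp (n * (Real.log (1 + g j * P') / 2 - 2 * ε)) * (4 * 
            Real.exp (-(n * (Real.log (1 + g j * P') / 2 - ε)))) := by gcongr
        _ = _ := by
          rw [mul_left_comm, ← Real.exp_add]; congr 2; ring
    have h3 : Real.exp (-(n * ε)) ≤ e / 24 := by
      rw [Real.exp_neg]
      have h4 := Real.add_one_le_exp (n * ε)
      have h5 : 24 / e < n * ε := by rwa [div_lt_iff₀ hε] at hn3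
      calc _ ≤ (24 / e)⁻¹ := by
            apply inv_anti₀ (by positivity); linarith
        _ = _ := by simp
    linarith
  calc _ ≤ ∑ j : Fin 3, ENNReal.ofReal (e / 3) := Finset.sum_le_sum fun j _ => hterm j
    _ = _ := by
      rw [← ENNReal.ofReal_sum_of_nonneg (fun _ _ => by positivity)]
      congr 1; simp; ring
end Core
end WT

namespace WT
open InformationTheory

section Core1
variable {A B D : Type} [Fintype A] [Fintype B] [Fintype D] [DecidableEq A] [DecidableEq B]
  [DecidableEq D] [Nonempty A] [Nonempty B] [Nonempty D]

lemma code_err (n : ℕ) (g : Fin 3 → ℝ) (P' ε : ℝ) (e : ℝ≥0∞) (c : A × (B × D) → (Fin n → ℝ))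
    (h : (Fintype.card (A × (B × D)) : ℝ≥0∞)⁻¹ * ∑ u, (gN n (g 0) (c u) 
          {y | (c u, y) ∈ TN n (g 0) P' ε}ᶜ + ∑ u' ∈ nb 0 u, gN n (g 0) (c u) 
            {y | (c u', y) ∈ TN n (g 0) P' ε}) ≤ e) :
    (Fintype.card (A × (B × D)) : ℝ≥0∞)⁻¹ * ∑ u, gN n (g 0) (c u) 
      {y | thDec c (TN n (g 0) P' ε) y ≠ u} ≤ e := by
  refine le_trans ?_ h
  gcongr with u
  exact thDec_err c _ _ u

/-- channel applied to a codebook -/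
def cbK {W : Type} [Fintype W] [MeasurableSpace W] [MeasurableSingletonClass W] (n : ℕ) (g : ℝ)
    (c : W → (Fin n → ℝ)) : Kernel W (Fin n → ℝ) := (gN n g).comap c (measurable_of_countable c)

instance {W : Type} [Fintype W] [MeasurableSpace W] [MeasurableSingletonClass W] (n : ℕ) (g : ℝ)
    (c : W → (Fin n → ℝ)) : IsMarkovKernel (cbK n g c) := by unfold cbK; infer_instance

lemma cbK_apply {W : Type} [Fintype W] [MeasurableSpace W] [MeasurableSingletonClass W] (n : ℕ)
    (g : ℝ) (c : W → (Fin n → ℝ)) (w : W) : cbK n g c w = gN n g (c w) := rfl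

lemma hasDens_cbK {W : Type} [Fintype W] [MeasurableSpace W] [MeasurableSingletonClass W] (n : ℕ)
    (g : ℝ) (c : W → (Fin n → ℝ)) (v : ℝ) (hv : 0 < v) : HasDens (cbK n g c) (qN n v) := by
  obtain ⟨f, hf, h⟩ := hasDens_gN n g v hv
  refine ⟨fun p => f (c p.1, p.2), ?_, fun w => h (c w)⟩
  have := measurable_of_countable c
  fun_prop

lemma code_leak {M W : Type} [Fintype M] [Nonempty M] [Fintype W] [Nonempty W] [DecidableEq W] 
    [MeasurableSpace W]
    [MeasurableSingletonClass W] (n : ℕ) (g P' P ε e : ℝ) (hg : 0 ≤ g) (hP : 0 ≤ P) (he : 0 ≤ e)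
    (c : M → W → (Fin n → ℝ)) (hc : ∀ m w, ∑ i, c m w i ^ 2 ≤ n * P)
    (h : ((Fintype.card M : ℝ≥0∞) * Fintype.card W)⁻¹ * ∑ m, ∑ w, (gN n g (c m w) 
          {y | (c m w, y) ∈ TN n g P' ε}ᶜ + ∑ w' ∈ Finset.univ.erase w, gN n g (c m w) 
            {y | (c m w', y) ∈ TN n g P' ε}) ≤ ENNReal.ofReal e) :
    (Fintype.card M : ℝ≥0∞)⁻¹ * ∑ m, klDiv (cbK n g (c m) ∘ₘ unif W) (qN n (1 + g * P)) ≤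
      ENNReal.ofReal (n * (Real.log (1 + g * P) / 2) - Real.log (Fintype.card W) + 1 + 
        e * (Real.log (Fintype.card W) + 1)) := by
  have hlog : 0 ≤ Real.log (1 + g * P) := Real.log_nonneg (by nlinarith [mul_nonneg hg hP])
  refine leak_avg (fun m => cbK n g (c m)) _ (fun m => hasDens_cbK n g _ _ (by positivity)) _ 
    (by positivity) (fun m w => kl_gN n g P hg hP _ (hc m w)) 
    (fun m w => {y | (c m w, y) ∈ TN n g P' ε}) 
    (fun m w => measurable_prodMk_left (TN_meas n g P' ε)) e he h

lemma nb_sum1 (F : A × (B × D) → A × (B × D) → ℝ≥0∞) (a : A) (w : B × D) :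
    ∑ u' ∈ nb 1 (a, w), F (a, w) u' = ∑ w' ∈ Finset.univ.erase w, F (a, w) (a, w') := by
  simp only [nb]
  exact Finset.sum_map _ _ _

lemma nb_sum2 (F : A × (B × D) → A × (B × D) → ℝ≥0∞) (a : A) (b : B) (d : D) :
    ∑ u' ∈ nb 2 (a, (b, d)), F (a, (b, d)) u' =
      ∑ d' ∈ Finset.univ.erase d, F (a, (b, d)) (a, (b, d')) := by
  simp only [nb]
  exact Finset.sum_map _ _ _

lemma core1 (g : Fin 3 → ℝ) (P' P ε e : ℝ) (hg : ∀ j, 0 ≤ g j) (hP' : 0 ≤ P')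
    (hPP : P' < P ∨ (P' = 0 ∧ P = 0)) (hε : 0 < ε) (he : 0 < e) :
    ∃ N : ℕ, ∀ n : ℕ, N ≤ n → ∀ (A B D : Type) [Fintype A] [Fintype B] [Fintype D] [DecidableEq A]
      [DecidableEq B] [DecidableEq D] [Nonempty A] [Nonempty B] [Nonempty D] [MeasurableSpace B]
      [MeasurableSpace D] [MeasurableSingletonClass B] [MeasurableSingletonClass D],
      (∀ j, ((![Fintype.card A * (Fintype.card B * Fintype.card D), 
        Fintype.card B * Fintype.card D, Fintype.card D] j : ℕ) : ℝ) - 1 ≤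
          Real.exp (n * (Real.log (1 + g j * P') / 2 - 2 * ε))) →
      ∃ c : A × (B × D) → (Fin n → ℝ), (∀ u, ∑ i, c u i ^ 2 ≤ n * P) ∧ 
        (Fintype.card (A × (B × D)) : ℝ≥0∞)⁻¹ * ∑ u, gN n (g 0) (c u) 
          {y | thDec c (TN n (g 0) P' ε) y ≠ u} ≤ ENNReal.ofReal e ∧
        (Fintype.card A : ℝ≥0∞)⁻¹ * ∑ a, klDiv (cbK n (g 1) (fun w => c (a, w)) ∘ₘ unif (B × D))
          (qN n (1 + g 1 * P)) ≤
          ENNReal.ofReal (n * (Real.log (1 + g 1 * P) / 2) - Real.log (Fintype.card (B × D)) + 1 + 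
            e * (Real.log (Fintype.card (B × D)) + 1)) ∧
        (Fintype.card (A × B) : ℝ≥0∞)⁻¹ * ∑ m : A × B, klDiv (cbK n (g 2) 
          (fun d => c (m.1, (m.2, d))) ∘ₘ unif D) (qN n (1 + g 2 * P)) ≤
          ENNReal.ofReal (n * (Real.log (1 + g 2 * P) / 2) - Real.log (Fintype.card D) + 1 + 
            e * (Real.log (Fintype.card D) + 1)) := by
  obtain ⟨N, hN⟩ := core0 g P' P ε e hg hP' hPP hε he
  have hP : 0 ≤ P := by rcases hPP with h | h <;> linarith
  refine ⟨N, fun n hn A B D _ _ _ _ _ _ _ _ _ _ _ _ _ hsz => ?_⟩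
  obtain ⟨c, hc, hce⟩ := hN n hn A B D hsz
  refine ⟨c, hc, code_err n g P' ε _ c (hce 0), ?_, ?_⟩
  · refine code_leak n (g 1) P' P ε e (hg 1) hP he.le (fun a w => c (a, w)) (fun a w => hc _) 
      (le_trans (le_of_eq ?_) (hce 1))
    rw [Fintype.sum_prod_type, Fintype.card_prod A, Nat.cast_mul]
    congr 1
    refine Finset.sum_congr rfl fun a _ => Finset.sum_congr rfl fun w _ => ?_
    congr 1
    exact (nb_sum1 (fun u u' => gN n (g 1) (c u) {y | (c u', y) ∈ TN n (g 1) P' ε}) a w).symm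
  · refine code_leak (M := A × B) n (g 2) P' P ε e (hg 2) hP he.le (fun m d => c (m.1, (m.2, d))) 
      (fun a w => hc _) (le_trans (le_of_eq ?_) (hce 2))
    rw [Fintype.sum_prod_type, Fintype.sum_prod_type, Fintype.card_prod A (B × D), 
      Fintype.card_prod A B, Fintype.card_prod B D]
    simp only [Fintype.sum_prod_type]
    congr 1
    · push_cast; rw [mul_assoc]
    refine Finset.sum_congr rfl fun a _ => Finset.sum_congr rfl fun b _ => 
      Finset.sum_congr rfl fun d _ => ?_
    congr 1
    exact (nb_sum2 (fun u u' => gN n (g 2) (c u) {y | (c u', y) ∈ TN n (g 2) P' ε}) a b d).symm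
end Core1
end WT

namespace WT
open InformationTheory
set_option linter.unusedSectionVars false

section Fin1
variable {M Y : Type*} [Fintype M] [Nonempty M] [MeasurableSpace M] [MeasurableSingletonClass M]
  [MeasurableSpace Y]

lemma hasDens_fin (κ : Kernel M Y) [IsMarkovKernel κ] (Q : Measure Y) [IsProbabilityMeasure Q]
    (h : ∀ m, κ m ≪ Q) : HasDens κ Q := by
  refine ⟨fun p => (κ p.1).rnDeriv Q p.2, ?_, fun m => ?_⟩
  · exact measurable_from_prod_countable_right fun m => Measure.measurable_rnDeriv (κ m) Q
  · exact (Measure.withDensity_rnDeriv_eq _ _ (h m)).symm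

lemma mi_avg (κ : Kernel M Y) [IsMarkovKernel κ] (Q : Measure Y) [IsProbabilityMeasure Q] :
    klDiv (κ ∘ₘ unif M) Q + miK (unif M) κ ≤ (Fintype.card M : ℝ≥0∞)⁻¹ * ∑ m, klDiv (κ m) Q := by
  by_cases h : ∀ m, klDiv (κ m) Q ≠ ⊤
  · rw [← lintegral_unif, mi_base (unif M) κ Q (hasDens_fin κ Q 
      fun m => (klDiv_ne_top_iff.1 (h m)).1)]
  · push Not at h
    obtain ⟨m, hm⟩ := h
    have : ∑ m, klDiv (κ m) Q = ⊤ := ENNReal.sum_eq_top.2 ⟨m, Finset.mem_univ m, hm⟩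
    rw [this, ENNReal.mul_top (by simp)]
    exact le_top
end Fin1

/-- a good code for one scalar subchannel -/
def ScalarCode (a b₁ b₂ P : ℝ) (n : ℕ) (M₁ M₂ : Type) [Fintype M₁] [Fintype M₂] 
    [MeasurableSpace M₁] [MeasurableSpace M₂] (ε : ℝ) : Prop :=
  ∃ enc : M₁ × M₂ → Measure (Fin n → ℝ), (∀ m, IsProbabilityMeasure (enc m)) ∧
    (∀ m, ∀ᵐ x ∂(enc m), ∑ i, x i ^ 2 ≤ n * P) ∧
    (∃ dec : (Fin n → ℝ) → M₁ × M₂, Measurable dec ∧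
      (Fintype.card (M₁ × M₂) : ℝ≥0∞)⁻¹ * ∑ m, ((enc m).bind (gN n a)) {y | dec y ≠ m} ≤
        ENNReal.ofReal ε) ∧
    (∃ Q : Measure (Fin n → ℝ), IsProbabilityMeasure Q ∧ 
      (Fintype.card (M₁ × M₂) : ℝ≥0∞)⁻¹ * ∑ m, klDiv ((enc m).bind (gN n b₂)) Q ≤
        ENNReal.ofReal (n * ε)) ∧
    (∃ Q : Measure (Fin n → ℝ), IsProbabilityMeasure Q ∧ 
      (Fintype.card M₁ : ℝ≥0∞)⁻¹ * ∑ m₁, 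
        klDiv (((unif M₂).bind fun m₂ => enc (m₁, m₂)).bind (gN n b₁)) Q ≤
        ENNReal.ofReal (n * ε))

section Conv
variable {A₁ A₂ B D : Type} [Fintype A₁] [Fintype A₂] [Fintype B] [Fintype D]
  [Nonempty A₁] [Nonempty A₂] [Nonempty B] [Nonempty D] 
  [MeasurableSpace A₁] [MeasurableSpace A₂] [MeasurableSpace B] [MeasurableSpace D]
  [MeasurableSingletonClass A₁] [MeasurableSingletonClass A₂]
  [MeasurableSingletonClass B] [MeasurableSingletonClass D]

lemma map_bind_cb {W : Type} [Fintype W] [MeasurableSpace W] [MeasurableSingletonClass W] (n : ℕ)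
    (g : ℝ) (c : W → (Fin n → ℝ)) : ((unif W).map c).bind (gN n g) = cbK n g c ∘ₘ unif W := by
  ext s hs
  have hc := measurable_of_countable c
  rw [Measure.bind_apply hs (Kernel.aemeasurable _), Measure.bind_apply hs (Kernel.aemeasurable _),
    lintegral_map (Kernel.measurable_coe _ hs) hc]
  rfl

/-- encoder from a codebook -/
def encC {n : ℕ} (c : (A₁ × A₂) × (B × D) → (Fin n → ℝ)) (m : A₁ × (A₂ × B)) : 
    Measure (Fin n → ℝ) := (unif D).map fun d => c ((m.1, m.2.1), (m.2.2, d))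

instance {n : ℕ} (c : (A₁ × A₂) × (B × D) → (Fin n → ℝ)) (m : A₁ × (A₂ × B)) :
    IsProbabilityMeasure (encC c m) := 
  Measure.isProbabilityMeasure_map (measurable_of_countable _).aemeasurable

lemma encC_bind {n : ℕ} (c : (A₁ × A₂) × (B × D) → (Fin n → ℝ)) (m : A₁ × (A₂ × B)) (g : ℝ) :
    (encC c m).bind (gN n g) = cbK n g (fun d => c ((m.1, m.2.1), (m.2.2, d))) ∘ₘ unif D := 
  map_bind_cb _ _ _

lemma encC_avg {n : ℕ} (c : (A₁ × A₂) × (B × D) → (Fin n → ℝ)) (m : A₁) (g : ℝ) {s : Set (Fin n → ℝ)}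
    (hs : MeasurableSet s) :
    (((unif (A₂ × B)).bind fun m₂ => encC c (m, m₂)).bind (gN n g)) s = 
      (Fintype.card A₂ : ℝ≥0∞)⁻¹ * ∑ a₂, (cbK n g (fun w => c ((m, a₂), w)) ∘ₘ unif (B × D)) s := by
  have h1 : ((unif (A₂ × B)).bind fun m₂ => encC c (m, m₂)).bind (gN n g) = 
      (unif (A₂ × B)).bind fun m₂ => (encC c (m, m₂)).bind (gN n g) := 
    Measure.bind_bind (measurable_of_countable _).aemeasurable (Kernel.aemeasurable _)
  rw [h1, Measure.bind_apply hs (measurable_of_countable _).aemeasurable, lintegral_unif]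
  simp_rw [encC_bind, comp_unif_apply _ hs, Fintype.sum_prod_type, cbK_apply]
  rw [Fintype.card_prod, Fintype.card_prod, Nat.cast_mul, Nat.cast_mul, 
    ENNReal.mul_inv (by simp) (by simp), ENNReal.mul_inv (by simp) (by simp), mul_assoc]
  congr 1
  simp_rw [Finset.mul_sum, mul_assoc]

lemma code_scalar (a b₁ b₂ b₁' b₂' P ε : ℝ) (n : ℕ) [DecidableEq A₁] [DecidableEq A₂]
    [DecidableEq B] [DecidableEq D]
    (c : (A₁ × A₂) × (B × D) → (Fin n → ℝ)) (hc : ∀ u, ∑ i, c u i ^ 2 ≤ n * P)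
    (T : Set ((Fin n → ℝ) × (Fin n → ℝ))) (hT : MeasurableSet T)
    (h0 : (Fintype.card ((A₁ × A₂) × (B × D)) : ℝ≥0∞)⁻¹ * ∑ u, gN n a (c u) 
          {y | thDec c T y ≠ u} ≤ ENNReal.ofReal ε)
    (Q₁ Q₂ : Measure (Fin n → ℝ)) [IsProbabilityMeasure Q₁] [IsProbabilityMeasure Q₂]
    (h1 : (Fintype.card (A₁ × A₂) : ℝ≥0∞)⁻¹ * ∑ a, klDiv (cbK n b₁' (fun w => c (a, w)) 
      ∘ₘ unif (B × D)) Q₁ ≤ ENNReal.ofReal (n * ε))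
    (h2 : (Fintype.card ((A₁ × A₂) × B) : ℝ≥0∞)⁻¹ * ∑ m : (A₁ × A₂) × B, klDiv (cbK n b₂'
          (fun d => c (m.1, (m.2, d))) ∘ₘ unif D) Q₂ ≤ ENNReal.ofReal (n * ε))
    (hb1 : b₁ = b₁' ∨ Fintype.card A₁ = 1) 
    (hb2 : b₂ = b₂' ∨ Fintype.card (A₁ × (A₂ × B)) = 1) :
    ScalarCode a b₁ b₂ P n A₁ (A₂ × B) ε := by
  refine ⟨encC c, fun m => inferInstance, fun m => ?_, ?_, ?_, ?_⟩
  · rw [encC, ae_map_iff (measurable_of_countable _).aemeasurable 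
      (measurableSet_le (by fun_prop) measurable_const)]
    exact Filter.Eventually.of_forall fun d => hc _
  · have hf : Measurable fun u : (A₁ × A₂) × (B × D) => (u.1.1, (u.1.2, u.2.1)) := by fun_prop
    have hd : Measurable (fun y => (fun u : (A₁ × A₂) × (B × D) => (u.1.1, (u.1.2, u.2.1))) 
      (thDec c T y)) := hf.comp (thDec_meas c T hT)
    refine ⟨_, hd, le_trans ?_ h0⟩
    have hs : ∀ m : A₁ × (A₂ × B), MeasurableSet {y | (fun u : (A₁ × A₂) × (B × D) => 
        (u.1.1, (u.1.2, u.2.1))) (thDec c T y) ≠ m} := fun m => 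
      (hd (measurableSet_singleton m)).compl
    simp_rw [encC_bind]
    have : ∀ m : A₁ × (A₂ × B), (cbK n a (fun d => c ((m.1, m.2.1), (m.2.2, d))) ∘ₘ unif D)
        {y | (fun u : (A₁ × A₂) × (B × D) => (u.1.1, (u.1.2, u.2.1))) (thDec c T y) ≠ m} ≤ 
        (Fintype.card D : ℝ≥0∞)⁻¹ * ∑ d, gN n a (c ((m.1, m.2.1), (m.2.2, d)))
          {y | thDec c T y ≠ ((m.1, m.2.1), (m.2.2, d))} := by
      intro m
      rw [comp_unif_apply _ (hs m)]
      refine mul_le_mul_right (Finset.sum_le_sum fun d _ => ?_) _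
      rw [cbK_apply]
      refine measure_mono (fun y hy => ?_)
      simp only [Set.mem_setOf_eq] at hy ⊢
      intro h
      exact hy (by simp only [h])
    refine le_trans (mul_le_mul_right (Finset.sum_le_sum fun m _ => this m) _) (le_of_eq ?_)
    rw [← Finset.mul_sum, ← mul_assoc]
    congr 1
    · simp only [Fintype.card_prod, Nat.cast_mul]
      rw [← ENNReal.mul_inv (by right; simp) (by right; simp)]
      congr 1; ring
    · simp only [Fintype.sum_prod_type]
  · rcases hb2 with rfl | hb
    · refine ⟨Q₂, inferInstance, le_trans (le_of_eq ?_) h2⟩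
      simp_rw [encC_bind]
      congr 1
      · simp only [Fintype.card_prod, Nat.cast_mul]; congr 1; ring
      · simp only [Fintype.sum_prod_type]
    · obtain ⟨m0, hm0⟩ := Fintype.card_eq_one_iff.1 hb
      refine ⟨(encC c m0).bind (gN n b₂), inferInstance, ?_⟩
      rw [Finset.sum_eq_zero]
      · simp
      · intro m _
        rw [hm0 m, klDiv_self]
  · rcases hb1 with rfl | hb
    · refine ⟨Q₁, inferInstance, le_trans ?_ h1⟩
      let κ : A₁ → Kernel A₂ (Fin n → ℝ) := fun m => Kernel.ofFunOfCountable fun a₂ => 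
        cbK n b₁ (fun w => c ((m, a₂), w)) ∘ₘ unif (B × D)
      have hκ : ∀ m a₂, κ m a₂ = cbK n b₁ (fun w => c ((m, a₂), w)) ∘ₘ unif (B × D) := 
        fun m a₂ => rfl
      have hκM : ∀ m, IsMarkovKernel (κ m) := fun m => ⟨fun a₂ => by rw [hκ]; infer_instance⟩
      have h3 : ∀ m, ((unif (A₂ × B)).bind fun m₂ => encC c (m, m₂)).bind (gN n b₁) = 
          κ m ∘ₘ unif A₂ := by
        intro m
        ext s hs
        rw [encC_avg c m b₁ hs, comp_unif_apply _ hs]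
        rfl
      simp_rw [h3]
      calc _ ≤ (Fintype.card A₁ : ℝ≥0∞)⁻¹ * ∑ m, ((Fintype.card A₂ : ℝ≥0∞)⁻¹ * ∑ a₂, 
            klDiv (κ m a₂) Q₁) := by
            gcongr with m
            exact le_self_add.trans (mi_avg (κ m) Q₁)
        _ = _ := by
          rw [← Finset.mul_sum, ← mul_assoc, Fintype.sum_prod_type, Fintype.card_prod, Nat.cast_mul,
            ENNReal.mul_inv (by simp) (by simp)]
          rfl
    · obtain ⟨m0, hm0⟩ := Fintype.card_eq_one_iff.1 hb
      have hP : IsProbabilityMeasure ((unif (A₂ × B)).bind fun m₂ => encC c (m0, m₂)) := by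
        let κ : Kernel (A₂ × B) (Fin n → ℝ) := Kernel.ofFunOfCountable fun m₂ => encC c (m0, m₂)
        have : IsMarkovKernel κ := ⟨fun m => by
          show IsProbabilityMeasure (encC c (m0, m)); infer_instance⟩
        show IsProbabilityMeasure (κ ∘ₘ unif (A₂ × B))
        infer_instance
      refine ⟨((unif (A₂ × B)).bind fun m₂ => encC c (m0, m₂)).bind (gN n b₁), inferInstance, ?_⟩
      rw [Finset.sum_eq_zero]
      · simp
      · intro m _
        rw [hm0 m, klDiv_self]
end Conv
end WT

namespace WT
open InformationTheory

lemma floor_exp {x : ℝ} (hx : 0 ≤ x) : ∃ k : ℕ, 0 < k ∧ (k : ℝ) ≤ Real.exp x ∧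
    x - 1 ≤ Real.log k ∧ Real.log k ≤ x := by
  have h1 : 1 ≤ Real.exp x := Real.one_le_exp hx
  have hk : 1 ≤ ⌊Real.exp x⌋₊ := Nat.le_floor (by simpa using h1)
  have hk' : (1 : ℝ) ≤ (⌊Real.exp x⌋₊ : ℝ) := by exact_mod_cast hk
  have hle : (⌊Real.exp x⌋₊ : ℝ) ≤ Real.exp x := Nat.floor_le (Real.exp_pos x).le
  have hlt := Nat.lt_floor_add_one (Real.exp x)
  refine ⟨⌊Real.exp x⌋₊, hk, hle, ?_, ?_⟩
  · rw [Real.le_log_iff_exp_le (by linarith), Real.exp_sub]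
    have h2 : 2 ≤ Real.exp 1 := by linarith [Real.add_one_le_exp (1 : ℝ)]
    rw [div_le_iff₀ (Real.exp_pos 1)]
    nlinarith
  · have := Real.log_le_log (by linarith) hle
    rwa [Real.log_exp] at this

lemma size_ok {n : ℕ} {c k : ℝ} (h : k ≤ Real.exp (n * max 0 c)) : k - 1 ≤ Real.exp (n * c) := by
  rcases le_total 0 c with hc | hc
  · rw [max_eq_right hc] at h; linarith
  · rw [max_eq_left hc] at h
    simp at h
    linarith [Real.exp_pos (n * c)]

lemma C_mono_g {g h p : ℝ} (hg : 0 ≤ g) (hgh : g ≤ h) (hp : 0 ≤ p) :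
    Real.log (1 + g * p) / 2 ≤ Real.log (1 + h * p) / 2 := by
  have : 0 ≤ g * p := mul_nonneg hg hp
  gcongr

lemma C_mono_p {g p q : ℝ} (hg : 0 ≤ g) (hp : 0 ≤ p) (hpq : p ≤ q) :
    Real.log (1 + g * p) / 2 ≤ Real.log (1 + g * q) / 2 := by
  have : 0 ≤ g * p := mul_nonneg hg hp
  gcongr

lemma C_nonneg {g p : ℝ} (hg : 0 ≤ g) (hp : 0 ≤ p) : 0 ≤ Real.log (1 + g * p) / 2 := by
  have : 0 ≤ g * p := mul_nonneg hg hp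
  have := Real.log_nonneg (show 1 ≤ 1 + g * p by linarith)
  linarith

lemma C_close {g p q a δ : ℝ} (hg : 0 ≤ g) (hga : g ≤ a) (hp : 0 ≤ p) (hq : p ≤ q) (hδ : 0 < δ)
    (h : q - p ≤ δ / (1 + a)) :
    Real.log (1 + g * q) / 2 ≤ Real.log (1 + g * p) / 2 + δ := by
  have h0 : 0 ≤ g * p := mul_nonneg hg hp
  have h0' : 0 ≤ g * q := mul_nonneg hg (hp.trans hq)
  have h1 : Real.log (1 + g * q) - Real.log (1 + g * p) ≤ δ := by
    rw [← Real.log_div (by linarith) (by linarith)]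
    refine (Real.log_le_sub_one_of_pos (by positivity)).trans ?_
    rw [sub_le_iff_le_add, div_le_iff₀ (by linarith)]
    have h2 : g * (q - p) ≤ δ := by
      rw [le_div_iff₀ (by linarith)] at h
      nlinarith
    nlinarith
  linarith

lemma leak_num {n C s k1 δ e Ca : ℝ} (hn1 : 1 ≤ n) (hn : 10 ≤ n * δ) (hδ : 0 < δ) (hCa : 0 ≤ Ca)
    (he : e = δ / (1 + Ca)) (hs : C - 3 * δ ≤ s) (hs' : s ≤ Ca) (h1 : n * s - 2 ≤ k1)
    (h2 : k1 ≤ n * s) : n * C - k1 + 1 + e * (k1 + 1) ≤ n * (10 * δ) := by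
  have he0 : 0 < e := by rw [he]; positivity
  have he1 : e * (1 + Ca) = δ := by rw [he]; field_simp
  have h3 : e * (k1 + 1) ≤ e * (n * (Ca + 1)) := by
    apply mul_le_mul_of_nonneg_left _ he0.le
    nlinarith
  have h4 : e * (n * (Ca + 1)) = n * δ := by rw [← he1]; ring
  nlinarith

lemma rate1 {n Ca C1 sA sB δ ε θ k : ℝ} (hn0 : 0 ≤ n) (hn : 10 ≤ n * δ) (hδ : 0 < δ)
    (hε : ε = 10 * δ) (hθ : 0 ≤ θ) (hθ1 : θ ≤ 1) (loA : Ca - 3 * δ ≤ sA) (upB : sB ≤ C1)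
    (h : n * (θ * (sA - sB)) - 1 ≤ k) : n * (θ * (Ca - C1) - ε) ≤ k := by
  refine le_trans ?_ h
  have h0 : θ * (Ca - C1 - 3 * δ) ≤ θ * (sA - sB) := 
    mul_le_mul_of_nonneg_left (by linarith) hθ
  have h1 : θ * (3 * δ) ≤ 3 * δ := by nlinarith
  have h2 := mul_le_mul_of_nonneg_left (show θ * (Ca - C1) - 3 * δ ≤ θ * (sA - sB) by linarith) hn0
  rw [hε]
  linarith

lemma rate2 {n Ca C1 C2 sA sB sD δ ε θ k k' : ℝ} (hn0 : 0 ≤ n) (hn : 10 ≤ n * δ) (hδ : 0 < δ)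
    (hε : ε = 10 * δ) (hθ : 0 ≤ θ) (hθ1 : θ ≤ 1) (upA : sA ≤ Ca) (loA : Ca - 3 * δ ≤ sA)
    (loB : C1 - 3 * δ ≤ sB) (upD : sD ≤ C2)
    (h : n * ((1 - θ) * (sA - sB)) - 1 ≤ k) (h' : n * (sB - sD) - 1 ≤ k') : 
    n * ((Ca - C2) - θ * (Ca - C1) - ε) ≤ k + k' := by
  have h0 : θ * (sA - sB) ≤ θ * (Ca - C1 + 3 * δ) := 
    mul_le_mul_of_nonneg_left (by linarith) hθ
  have h1 : θ * (3 * δ) ≤ 3 * δ := by nlinarith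
  have h2 := mul_le_mul_of_nonneg_left (show θ * (sA - sB) ≤ θ * (Ca - C1) + 3 * δ by linarith) hn0
  have h3 : n * ((1 - θ) * (sA - sB)) = n * (sA - sB) - n * (θ * (sA - sB)) := by ring
  have h4 : n * (Ca - 3 * δ - C2) ≤ n * (sA - sD) := mul_le_mul_of_nonneg_left (by linarith) hn0
  rw [hε]
  linarith

set_option maxHeartbeats 1000000 in
lemma scalar (a b₁ b₂ P θ ε : ℝ) (ha : 0 ≤ a) (hb₂ : 0 ≤ b₂) (hb : b₂ ≤ b₁) (hP : 0 ≤ P)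
    (hθ : 0 ≤ θ) (hθ1 : θ ≤ 1) (hε : 0 < ε) :
    ∃ N : ℕ, ∀ n : ℕ, N ≤ n → ∃ k1 ka kb : ℕ, 0 < k1 ∧ 0 < ka ∧ 0 < kb ∧ 
      ScalarCode a b₁ b₂ P n (Fin k1) (Fin ka × Fin kb) ε ∧
      n * (θ * (Real.log (1 + a * P) / 2 - Real.log (1 + min a b₁ * P) / 2) - ε) ≤ Real.log k1 ∧
      n * ((Real.log (1 + a * P) / 2 - Real.log (1 + min a b₂ * P) / 2) - 
        θ * (Real.log (1 + a * P) / 2 - Real.log (1 + min a b₁ * P) / 2) - ε) ≤ 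
        Real.log (ka * kb) := by
  set δ := ε / 10 with hδd
  have hδ : 0 < δ := by positivity
  have hb₁ : 0 ≤ b₁ := hb₂.trans hb
  set c1 := min a b₁ with hc1
  set c2 := min a b₂ with hc2
  have hc10 : 0 ≤ c1 := le_min ha hb₁
  have hc20 : 0 ≤ c2 := le_min ha hb₂
  have hc1a : c1 ≤ a := min_le_left _ _
  have hc2a : c2 ≤ a := min_le_left _ _
  have hc21 : c2 ≤ c1 := min_le_min_left _ hb
  set P' := max 0 (P - δ / (1 + a)) with hP'd
  have hP' : 0 ≤ P' := le_max_left _ _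
  have hda : 0 < δ / (1 + a) := by positivity
  have hP'P : P' ≤ P := max_le hP (by linarith)
  have hPd : P - P' ≤ δ / (1 + a) := by linarith [le_max_right 0 (P - δ / (1 + a))]
  have hPP : P' < P ∨ (P' = 0 ∧ P = 0) := by
    rcases hP.eq_or_lt with h | h
    · right; exact ⟨by linarith, h.symm⟩
    · left; exact max_lt h (by linarith)
  set Ca := Real.log (1 + a * P) / 2 with hCa
  have hCa0 : 0 ≤ Ca := C_nonneg ha hP
  set e := δ / (1 + Ca) with he
  have he0 : 0 < e := by positivity
  have heδ : e ≤ δ := by rw [he]; exact div_le_self hδ.le (by linarith)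
  obtain ⟨N, hN⟩ := core1 ![a, c1, c2] P' P δ e (by intro j; fin_cases j <;> simpa) hP' hPP hδ he0
  obtain ⟨N', hN'⟩ := exists_nat_ge (10 / δ)
  refine ⟨max N (max N' 1), fun n hn => ?_⟩
  have hn1 : (1 : ℝ) ≤ n := by exact_mod_cast (le_trans (le_max_right _ _) (le_trans (le_max_right _ _) hn))
  have hnd : 10 ≤ n * δ := by
    rw [← div_le_iff₀ hδ]
    exact hN'.trans (by exact_mod_cast (le_trans (le_max_left _ _) (le_trans (le_max_right _ _) hn)))
  have hn0 : (0 : ℝ) ≤ n := by linarith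
  -- exponents
  set sA := max 0 (Real.log (1 + a * P') / 2 - 2 * δ) with hsA
  set sB := max 0 (Real.log (1 + c1 * P') / 2 - 2 * δ) with hsB
  set sD := max 0 (Real.log (1 + c2 * P') / 2 - 2 * δ) with hsD
  have hsD0 : 0 ≤ sD := le_max_left _ _
  have hsDB : sD ≤ sB := max_le_max le_rfl (by linarith [C_mono_g hc20 hc21 hP'])
  have hsBA : sB ≤ sA := max_le_max le_rfl (by linarith [C_mono_g hc10 hc1a hP'])
  have up : ∀ g, 0 ≤ g → max 0 (Real.log (1 + g * P') / 2 - 2 * δ) ≤ Real.log (1 + g * P) / 2 :=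
    fun g hg => max_le (C_nonneg hg hP) (by linarith [C_mono_p hg hP' hP'P])
  have lo : ∀ g, 0 ≤ g → g ≤ a → 
      Real.log (1 + g * P) / 2 - 3 * δ ≤ max 0 (Real.log (1 + g * P') / 2 - 2 * δ) :=
    fun g hg hga => le_trans (by linarith [C_close hg hga hP' hP'P hδ hPd]) (le_max_right _ _)
  have upA := up a ha
  have upB := up c1 hc10
  have upD := up c2 hc20
  have loA := lo a ha le_rfl
  have loB := lo c1 hc10 hc1a
  have loD := lo c2 hc20 hc2a
  rw [← hsA] at upA loA
  rw [← hsB] at upB loB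
  rw [← hsD] at upD loD
  have hθ' : 0 ≤ 1 - θ := by linarith
  have hxA : 0 ≤ sA - sB := by linarith
  have hxB : 0 ≤ sB - sD := by linarith
  obtain ⟨kd, kd0, kdu, kdl, kdL⟩ := floor_exp (mul_nonneg hn0 hsD0)
  obtain ⟨kb, kb0, kbu, kbl, kbL⟩ := floor_exp (mul_nonneg hn0 hxB)
  obtain ⟨k1, k10, k1u, k1l, k1L⟩ := floor_exp (mul_nonneg hn0 (mul_nonneg hθ hxA))
  obtain ⟨ka, ka0, kau, kal, kaL⟩ := floor_exp (mul_nonneg hn0 (mul_nonneg hθ' hxA))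
  have hkd : (0 : ℝ) < kd := by exact_mod_cast kd0
  have hkb : (0 : ℝ) < kb := by exact_mod_cast kb0
  have hk1 : (0 : ℝ) < k1 := by exact_mod_cast k10
  have hka : (0 : ℝ) < ka := by exact_mod_cast ka0
  refine ⟨k1, ka, kb, k10, ka0, kb0, ?_, ?_, ?_⟩
  · have : Nonempty (Fin k1) := ⟨⟨0, k10⟩⟩
    have : Nonempty (Fin ka) := ⟨⟨0, ka0⟩⟩
    have : Nonempty (Fin kb) := ⟨⟨0, kb0⟩⟩
    have : Nonempty (Fin kd) := ⟨⟨0, kd0⟩⟩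
    have m2 : (kb : ℝ) * kd ≤ Real.exp (n * sB) := by
      calc (kb : ℝ) * kd ≤ Real.exp (n * (sB - sD)) * Real.exp (n * sD) := by gcongr
        _ = _ := by rw [← Real.exp_add]; congr 1; ring
    have m3 : (k1 * ka : ℝ) * (kb * kd) ≤ Real.exp (n * sA) := by
      calc (k1 * ka : ℝ) * (kb * kd) ≤ 
            (Real.exp (n * (θ * (sA - sB))) * Real.exp (n * ((1 - θ) * (sA - sB)))) * 
              Real.exp (n * sB) := by gcongr
        _ = _ := by rw [← Real.exp_add, ← Real.exp_add]; congr 1; ring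
    obtain ⟨c, hc, h0, h1, h2⟩ := hN n (le_trans (le_max_left _ _) hn) (Fin k1 × Fin ka) (Fin kb) 
      (Fin kd) (by
        intro j
        fin_cases j
        · simpa using size_ok m3
        · simpa using size_ok m2
        · simpa using size_ok kdu)
    have hlog : Real.log (Fintype.card (Fin kb × Fin kd)) = Real.log kb + Real.log kd := by
      simp only [Fintype.card_prod, Fintype.card_fin, Nat.cast_mul]
      exact Real.log_mul hkb.ne' hkd.ne'
    have hε' : ε = 10 * δ := by rw [hδd]; ring
    refine code_scalar a b₁ b₂ c1 c2 P ε n c hc (TN n a P' δ) (TN_meas n a P' δ) 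
      (h0.trans (ENNReal.ofReal_le_ofReal (by linarith))) (qN n (1 + c1 * P)) (qN n (1 + c2 * P)) 
      (h1.trans (ENNReal.ofReal_le_ofReal ?_)) (h2.trans (ENNReal.ofReal_le_ofReal ?_)) ?_ ?_
    · rw [hlog, hε']
      refine leak_num hn1 hnd hδ hCa0 he loB (hsBA.trans upA) ?_ ?_
      · linarith
      · linarith
    · rw [hε', Fintype.card_fin]
      refine leak_num hn1 hnd hδ hCa0 he loD (hsDB.trans (hsBA.trans upA)) ?_ ?_
      · linarith
      · linarith
    · rcases le_total b₁ a with h | h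
      · left; exact (min_eq_right h).symm
      · right
        have : sA - sB = 0 := by rw [hsA, hsB, hc1, min_eq_left h, sub_self]
        rw [this] at k1u
        simp at k1u
        rw [Fintype.card_fin]; omega
    · rcases le_total b₂ a with h | h
      · left; exact (min_eq_right h).symm
      · right
        have e1 : sA - sB = 0 := by rw [hsA, hsB, hc1, min_eq_left (h.trans hb), sub_self]
        have e2 : sB - sD = 0 := by 
          rw [hsB, hsD, hc1, hc2, min_eq_left (h.trans hb), min_eq_left h, sub_self]
        rw [e1] at k1u kau
        rw [e2] at kbu
        simp at k1u kau kbu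
        have q1 : k1 = 1 := by omega
        have q2 : ka = 1 := by omega
        have q3 : kb = 1 := by omega
        simp [q1, q2, q3]
  · exact rate1 hn0 hnd hδ (by rw [hδd]; ring) hθ hθ1 loA upB k1l
  · rw [Real.log_mul hka.ne' hkb.ne']
    exact rate2 hn0 hnd hδ (by rw [hδd]; ring) hθ hθ1 upA loA loB upD kal kbl
end WT

namespace WT
open InformationTheory

/-- exchange of time and subchannel index -/
def flipE (L n : ℕ) : (Fin L → Fin n → ℝ) ≃ᵐ (Fin n → Fin L → ℝ) where
  toFun x i l := x l i
  invFun y l i := y i l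
  left_inv _ := rfl
  right_inv _ := rfl
  measurable_toFun := by
    show Measurable fun (x : Fin L → Fin n → ℝ) (i : Fin n) (l : Fin L) => x l i
    fun_prop
  measurable_invFun := by
    show Measurable fun (y : Fin n → Fin L → ℝ) (l : Fin L) (i : Fin n) => y i l
    fun_prop

lemma flipE_apply {L n : ℕ} (x : Fin L → Fin n → ℝ) (i l) : flipE L n x i l = x l i := rfl
lemma flipE_symm_apply {L n : ℕ} (x : Fin n → Fin L → ℝ) (i l) : (flipE L n).symm x l i = x i l := rfl

lemma pi_flip {L n : ℕ} (μ : Fin n → Fin L → Measure ℝ) [∀ i l, IsProbabilityMeasure (μ i l)] :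
    (Measure.pi fun i => Measure.pi fun l => μ i l) =
      (Measure.pi fun l => Measure.pi fun i => μ i l).map (flipE L n) := by
  refine Measure.pi_eq_generateFrom (fun _ => generateFrom_pi) (fun _ => isPiSystem_pi)
    (fun i => ⟨fun _ => Set.univ, fun _ => ⟨fun _ => Set.univ, by simp, by simp⟩, fun _ => measure_lt_top _ _,
      Set.iUnion_const _⟩) fun s hs => ?_
  choose t ht hst using hs
  have : flipE L n ⁻¹' (Set.univ.pi s) = Set.univ.pi fun l => Set.univ.pi fun i => t i l := by
    ext x
    simp only [Set.mem_preimage, Set.mem_univ_pi, ← hst]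
    exact ⟨fun h l i => h i l, fun h i l => h l i⟩
  rw [MeasurableEquiv.map_apply, this, Measure.pi_pi]
  simp_rw [Measure.pi_pi, ← hst, Measure.pi_pi]
  exact Finset.prod_comm

lemma parOut_flip {L n : ℕ} (g : Fin L → ℝ) (x : Fin L → Fin n → ℝ) :
    parOut g (flipE L n x) = (piK (fun l => gN n (g l)) x).map (flipE L n) := 
  pi_flip fun i l => gaussianReal (Real.sqrt (g l) * x l i) 1

lemma bind_flip {L n : ℕ} (g : Fin L → ℝ) (E : Fin L → Measure (Fin n → ℝ)) 
    [∀ l, IsProbabilityMeasure (E l)] :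
    ((Measure.pi E).map (flipE L n)).bind (parOut g) = 
      (Measure.pi fun l => (E l).bind (gN n (g l))).map (flipE L n) := by
  rw [← pi_bind]
  ext s hs
  have hm : Measurable (parOut (n := n) g) := (parK n g).measurable
  rw [Measure.bind_apply hs hm.aemeasurable, 
    lintegral_map (f := fun a => parOut g a s) ((Measure.measurable_coe hs).comp hm) 
      (flipE L n).measurable,
    Measure.map_apply (flipE L n).measurable hs, 
    Measure.bind_apply ((flipE L n).measurable hs) (Kernel.aemeasurable _)]
  refine lintegral_congr fun x => ?_
  rw [parOut_flip, Measure.map_apply (flipE L n).measurable hs]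

section U
variable {A B : Type*} [Fintype A] [Fintype B] [MeasurableSpace A] [MeasurableSpace B]
  [MeasurableSingletonClass A] [MeasurableSingletonClass B]

lemma unif_singleton (a : A) : unif A {a} = (Fintype.card A : ℝ≥0∞)⁻¹ := by
  rw [unif]; simp

lemma unif_equiv (e : A ≃ B) : (unif A).map e = unif B := by
  refine Measure.ext_of_singleton fun b => ?_
  rw [Measure.map_apply (measurable_of_countable _) (measurableSet_singleton b)]
  have : e ⁻¹' {b} = {e.symm b} := by ext x; simp [Equiv.eq_symm_apply]
  rw [this, unif_singleton, unif_singleton, Fintype.card_congr e]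

lemma unif_prod [Nonempty A] [Nonempty B] : unif (A × B) = (unif A).prod (unif B) := by
  refine Measure.ext_of_singleton fun b => ?_
  obtain ⟨a, b⟩ := b
  rw [← Set.singleton_prod_singleton, Measure.prod_prod, Set.singleton_prod_singleton,
    unif_singleton, unif_singleton, unif_singleton, Fintype.card_prod, Nat.cast_mul, 
    ENNReal.mul_inv (by simp) (by simp)]

lemma unif_pi {L : ℕ} {M : Fin L → Type} [∀ l, Fintype (M l)] [∀ l, Nonempty (M l)]
    [∀ l, MeasurableSpace (M l)] [∀ l, MeasurableSingletonClass (M l)] :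
    unif (∀ l, M l) = Measure.pi fun l => unif (M l) := by
  refine Measure.ext_of_singleton fun b => ?_
  rw [← Set.univ_pi_singleton, Measure.pi_pi, Set.univ_pi_singleton, unif_singleton]
  simp_rw [unif_singleton]
  rw [Fintype.card_pi, Nat.cast_prod, ENNReal.prod_inv_distrib]
  intro i _ j _ _
  simp

lemma unif_eval {L : ℕ} {M : Fin L → Type} [∀ l, Fintype (M l)] [∀ l, Nonempty (M l)]
    [∀ l, MeasurableSpace (M l)] [∀ l, MeasurableSingletonClass (M l)] (e : A ≃ ∀ l, M l) (l) :
    (unif A).map (fun x => e x l) = unif (M l) := by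
  have h : (fun x => e x l) = Function.eval l ∘ e := rfl
  rw [h, ← Measure.map_map (measurable_pi_apply l) (measurable_of_countable _), unif_equiv, unif_pi]
  exact (measurePreserving_eval (fun l => unif (M l)) l).map_eq

end U
end WT

namespace WT
open InformationTheory

lemma mi_final {X Y : Type*} [Fintype X] [Nonempty X] [MeasurableSpace X] [MeasurableSingletonClass X]
    [MeasurableSpace Y] (κ : Kernel X Y) [IsMarkovKernel κ] (Q : Measure Y) [IsProbabilityMeasure Q]
    {r : ℝ} (hr : 0 ≤ r) (h : (Fintype.card X : ℝ≥0∞)⁻¹ * ∑ m, klDiv (κ m) Q ≤ ENNReal.ofReal r) :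
    miBits (unif X ⊗ₘ κ) ≤ r / Real.log 2 := by
  have h1 : miK (unif X) κ ≤ ENNReal.ofReal r := le_add_self.trans ((mi_avg κ Q).trans h)
  have h2 : miK (unif X) κ ≠ ⊤ := ne_top_of_le_ne_top ENNReal.ofReal_ne_top h1
  rw [miBits_eq _ _ h2]
  have := Real.log_pos (show (1 : ℝ) < 2 by norm_num)
  gcongr
  exact ENNReal.toReal_le_of_le_ofReal hr h1

lemma avg_proj {X A : Type*} [Fintype X] [MeasurableSpace X] [MeasurableSingletonClass X]
    [Fintype A] [MeasurableSpace A] [MeasurableSingletonClass A] (p : X → A)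
    (hp : (unif X).map p = unif A) (f : A → ℝ≥0∞) :
    (Fintype.card X : ℝ≥0∞)⁻¹ * ∑ x, f (p x) = (Fintype.card A : ℝ≥0∞)⁻¹ * ∑ a, f a := by
  rw [← lintegral_unif, ← lintegral_unif, ← hp, 
    lintegral_map (measurable_of_countable _) (measurable_of_countable _)]

lemma avg_sum {X : Type*} [Fintype X] [MeasurableSpace X] [MeasurableSingletonClass X] {L : ℕ}
    {A : Fin L → Type} 
    [∀ l, Fintype (A l)] [∀ l, MeasurableSpace (A l)] [∀ l, MeasurableSingletonClass (A l)]
    (p : ∀ l, X → A l) (hp : ∀ l, (unif X).map (p l) = unif (A l)) (f : ∀ l, A l → ℝ≥0∞) (r : ℝ)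
    (h : ∀ l, (Fintype.card (A l) : ℝ≥0∞)⁻¹ * ∑ a, f l a ≤ ENNReal.ofReal r) :
    (Fintype.card X : ℝ≥0∞)⁻¹ * ∑ x, ∑ l, f l (p l x) ≤ ENNReal.ofReal (L * r) := by
  rw [Finset.sum_comm, Finset.mul_sum]
  simp_rw [avg_proj (p _) (hp _) (f _)]
  refine (Finset.sum_le_sum fun l _ => h l).trans ?_
  rw [Finset.sum_const, Finset.card_univ, Fintype.card_fin, nsmul_eq_mul, 
    ENNReal.ofReal_mul (by positivity), ENNReal.ofReal_natCast]

section A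
variable {L n K₁ K₂ : ℕ} {M₁ M₂ : Fin L → Type} [∀ l, Fintype (M₁ l)] [∀ l, Fintype (M₂ l)]
  [∀ l, Nonempty (M₁ l)] [∀ l, Nonempty (M₂ l)]
  [∀ l, MeasurableSpace (M₁ l)] [∀ l, MeasurableSpace (M₂ l)] 
  [∀ l, MeasurableSingletonClass (M₁ l)] [∀ l, MeasurableSingletonClass (M₂ l)]

lemma par_code [NeZero K₁] [NeZero K₂] (a b₁ b₂ P : Fin L → ℝ) (Pt ε : ℝ) (hP : ∑ l, P l ≤ Pt)
    (hε : 0 ≤ ε) (e₁ : Fin K₁ ≃ ∀ l, M₁ l) (e₂ : Fin K₂ ≃ ∀ l, M₂ l)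
    (hS : ∀ l, ScalarCode (a l) (b₁ l) (b₂ l) (P l) n (M₁ l) (M₂ l) ε) :
    ∃ enc : Fin K₁ × Fin K₂ → Measure (Fin n → Fin L → ℝ),
      (∀ m, IsProbabilityMeasure (enc m)) ∧
      (∀ m, enc m (totalPow L Pt n) = 1) ∧
      ∃ dec : (Fin n → Fin L → ℝ) → Fin K₁ × Fin K₂, Measurable dec ∧
        (jointLawPar a enc {p | dec p.2 ≠ p.1}).toReal ≤ L * ε ∧
        miBits (jointLawPar b₂ enc) ≤ L * (n * ε) / Real.log 2 ∧
        miBits ((jointLawPar b₁ enc).map fun p => (p.1.1, p.2)) ≤ L * (n * ε) / Real.log 2 := by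
  choose en hpr hpow hdec hQ2 hQ1 using hS
  choose de hdm herr using hdec
  choose Q2 hQ2p hQ2 using hQ2
  choose Q1 hQ1p hQ1 using hQ1
  let pr : ∀ l, Fin K₁ × Fin K₂ → M₁ l × M₂ l := fun l m => (e₁ m.1 l, e₂ m.2 l)
  have hprm : ∀ l, (unif (Fin K₁ × Fin K₂)).map (pr l) = unif (M₁ l × M₂ l) := by
    intro l
    rw [unif_prod, unif_prod, ← unif_eval e₁ l, ← unif_eval e₂ l, 
      Measure.map_prod_map _ _ (measurable_of_countable _) (measurable_of_countable _)]
    rfl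
  let enc : Fin K₁ × Fin K₂ → Measure (Fin n → Fin L → ℝ) := fun m => 
    (Measure.pi fun l => en l (pr l m)).map (flipE L n)
  have henc : ∀ m, IsProbabilityMeasure (enc m) := fun m => 
    Measure.isProbabilityMeasure_map (flipE L n).measurable.aemeasurable
  have hout : ∀ (g : Fin L → ℝ) m, (parK n g ∘ₖ encK enc) m = 
      (Measure.pi fun l => (en l (pr l m)).bind (gN n (g l))).map (flipE L n) := by
    intro g m
    rw [Kernel.comp_apply, encK_apply]
    exact bind_flip g _
  have hpi2 : ∀ Q : Fin L → Measure (Fin n → ℝ), (∀ l, IsProbabilityMeasure (Q l)) → 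
      IsProbabilityMeasure ((Measure.pi Q).map (flipE L n)) := fun Q _ => 
    Measure.isProbabilityMeasure_map (flipE L n).measurable.aemeasurable
  refine ⟨enc, henc, fun m => ?_, ?_⟩
  · have hms : MeasurableSet (totalPow L Pt n) := 
      measurableSet_le (by fun_prop) measurable_const
    rw [← prob_compl_eq_zero_iff hms, ← mem_ae_iff, 
      mem_ae_map_iff (flipE L n).measurable.aemeasurable hms]
    have h1 : ∀ l, ∀ᵐ x ∂(Measure.pi fun l => en l (pr l m)), ∑ i, x l i ^ 2 ≤ n * P l := by
      intro l
      exact (measurePreserving_eval (fun l => en l (pr l m)) l).quasiMeasurePreserving.ae 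
        (hpow l (pr l m))
    have h2 := ae_all_iff.2 h1
    filter_upwards [h2] with x hx
    show ∑ l, ∑ i, (x l i) ^ 2 ≤ (n : ℝ) * Pt
    calc _ ≤ ∑ l, n * P l := Finset.sum_le_sum fun l _ => hx l
      _ ≤ _ := by rw [← Finset.mul_sum]; gcongr
  · let dec : (Fin n → Fin L → ℝ) → Fin K₁ × Fin K₂ := fun y => 
      (e₁.symm fun l => (de l ((flipE L n).symm y l)).1, e₂.symm fun l => (de l ((flipE L n).symm y l)).2)
    have hdc : ∀ l, Measurable fun y : Fin n → Fin L → ℝ => de l ((flipE L n).symm y l) := fun l => 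
      (hdm l).comp ((measurable_pi_apply l).comp (flipE L n).symm.measurable)
    have hdecm : Measurable dec := by
      refine Measurable.prodMk ?_ ?_
      · exact (measurable_of_countable e₁.symm).comp (measurable_pi_lambda _ fun l => (hdc l).fst)
      · exact (measurable_of_countable e₂.symm).comp (measurable_pi_lambda _ fun l => (hdc l).snd)
    refine ⟨dec, hdecm, ?_, ?_, ?_⟩
    · rw [joint_eq, unif_compProd_apply]
      · refine ENNReal.toReal_le_of_le_ofReal (by positivity) ?_
        refine le_trans (mul_le_mul_right (Finset.sum_le_sum fun m _ => ?_) _) 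
          (avg_sum pr hprm (fun l m => ((en l m).bind (gN n (a l))) {y | de l y ≠ m}) ε herr)
        rw [hout, MeasurableEquiv.map_apply]
        have hb : ∀ l, IsProbabilityMeasure ((en l (pr l m)).bind (gN n (a l))) := fun l => by
          infer_instance
        calc _ ≤ (Measure.pi fun l => (en l (pr l m)).bind (gN n (a l))) 
              (⋃ l, Function.eval l ⁻¹' {y | de l y ≠ pr l m}) := by
              refine measure_mono fun y hy => ?_
              by_contra hc
              apply hy
              simp only [Set.mem_iUnion, not_exists] at hc
              have hc' : ∀ l, de l (y l) = pr l m := fun l => not_not.1 (hc l)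
              show dec (flipE L n y) = m
              simp only [dec, MeasurableEquiv.symm_apply_apply, hc', pr]
              exact Prod.ext (e₁.symm_apply_apply _) (e₂.symm_apply_apply _)
          _ ≤ ∑ l, (Measure.pi fun l => (en l (pr l m)).bind (gN n (a l))) 
              (Function.eval l ⁻¹' {y | de l y ≠ pr l m}) := measure_iUnion_fintype_le _ _
          _ = _ := by
              refine Finset.sum_congr rfl fun l _ => ?_
              exact (measurePreserving_eval (fun l => (en l (pr l m)).bind (gN n (a l))) l).measure_preimage
                (hdm l (measurableSet_singleton _)).compl.nullMeasurableSet
      · exact (measurableSet_eq_fun (hdecm.comp measurable_snd) measurable_fst).compl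
    · rw [joint_eq]
      have := hpi2 Q2 hQ2p
      refine mi_final _ ((Measure.pi Q2).map (flipE L n)) (by positivity) ?_
      refine le_trans (le_of_eq ?_) 
        (avg_sum pr hprm (fun l m => klDiv ((en l m).bind (gN n (b₂ l))) (Q2 l)) (n * ε) hQ2)
      congr 1
      refine Finset.sum_congr rfl fun m _ => ?_
      rw [hout, kl_equiv, kl_pi]
    · rw [joint_eq1]
      have := hpi2 Q1 hQ1p
      refine mi_final _ ((Measure.pi Q1).map (flipE L n)) (by positivity) ?_
      let κ : ∀ l, M₁ l → Kernel (M₂ l) (Fin n → ℝ) := fun l m₁ => Kernel.ofFunOfCountable fun m₂ => 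
        en l (m₁, m₂)
      have hκ : ∀ l m₁, IsMarkovKernel (κ l m₁) := fun l m₁ => ⟨fun m₂ => hpr l (m₁, m₂)⟩
      have h1 : ∀ m₁, (encK enc ∘ₖ addK K₁ K₂) m₁ = 
          (Measure.pi fun l => κ l (e₁ m₁ l) ∘ₘ unif (M₂ l)).map (flipE L n) := by
        intro m₁
        rw [← pi_bind, ← unif_pi, ← unif_equiv e₂]
        ext s hs
        rw [Kernel.comp_apply, Measure.bind_apply hs (Kernel.aemeasurable _), addK_apply,
          lintegral_map (Kernel.measurable_coe _ hs) (measurable_of_countable _),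
          MeasurableEquiv.map_apply,
          Measure.bind_apply ((flipE L n).measurable hs) (Kernel.aemeasurable _),
          lintegral_map (Kernel.measurable_coe _ ((flipE L n).measurable hs)) (measurable_of_countable _)]
        refine lintegral_congr fun m₂ => ?_
        rw [encK_apply, MeasurableEquiv.map_apply]
        rfl
      have h2 : ∀ m₁, (parK n b₁ ∘ₖ (encK enc ∘ₖ addK K₁ K₂)) m₁ = 
          (Measure.pi fun l => (κ l (e₁ m₁ l) ∘ₘ unif (M₂ l)).bind (gN n (b₁ l))).map (flipE L n) := by
        intro m₁
        rw [Kernel.comp_apply, h1]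
        exact bind_flip b₁ _
      refine le_trans (le_of_eq ?_) 
        (avg_sum (fun l m₁ => e₁ m₁ l) (fun l => unif_eval e₁ l) 
          (fun l m₁ => klDiv (((unif (M₂ l)).bind fun m₂ => en l (m₁, m₂)).bind (gN n (b₁ l))) (Q1 l)) 
          (n * ε) hQ1)
      congr 1
      refine Finset.sum_congr rfl fun m _ => ?_
      rw [h2, kl_equiv, kl_pi]
      rfl
end A
end WT

namespace WT
open InformationTheory

lemma Cs_eq {P a b : ℝ} (hP : 0 ≤ P) (ha : 0 ≤ a) (hb : 0 ≤ b) :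
    Cs P a b * Real.log 2 = Real.log (1 + a * P) / 2 - Real.log (1 + min a b * P) / 2 := by
  have h2 := Real.log_pos (show (1 : ℝ) < 2 by norm_num)
  have h : (1 / 2) * Real.logb 2 (1 + a * P) - (1 / 2) * Real.logb 2 (1 + b * P) = 
      (Real.log (1 + a * P) / 2 - Real.log (1 + b * P) / 2) / Real.log 2 := by
    rw [Real.logb, Real.logb]; ring
  rw [Cs, h]
  rcases le_total b a with hab | hab
  · have := C_mono_g hb hab hP
    rw [max_eq_right (div_nonneg (by linarith) h2.le), min_eq_right hab]
    field_simp
  · have := C_mono_g ha hab hP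
    rw [max_eq_left (div_nonpos_of_nonpos_of_nonneg (by linarith) h2.le), min_eq_left hab]
    simp

lemma ach (L : ℕ) (a b₁ b₂ : Fin L → ℝ)
    (P : ℝ) (ha : ∀ l, 0 ≤ a l) (hb₁₂ : ∀ l, b₁ l ≥ b₂ l) (hb₂ : ∀ l, b₂ l ≥ 0)
    (R₁ R₂ : ℝ) (hR₁ : 0 ≤ R₁) (Pl : Fin L → ℝ) (hPl : ∀ l, 0 ≤ Pl l) (hPs : ∑ l, Pl l ≤ P)
    (h1 : R₁ ≤ ∑ l, Cs (Pl l) (a l) (b₁ l)) (h2 : R₁ + R₂ ≤ ∑ l, Cs (Pl l) (a l) (b₂ l)) :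
    ParAchievable L a b₁ b₂ (totalPow L P) R₁ R₂ := by
  intro ε hε
  have hl2 := Real.log_pos (show (1 : ℝ) < 2 by norm_num)
  have hl21 : Real.log 2 ≤ 1 := by linarith [Real.log_le_sub_one_of_pos (show (0 : ℝ) < 2 by norm_num)]
  obtain ⟨θ, hθ0, hθ1, hθ⟩ : ∃ θ : ℝ, 0 ≤ θ ∧ θ ≤ 1 ∧ θ * ∑ l, Cs (Pl l) (a l) (b₁ l) = R₁ := by
    rcases hR₁.eq_or_lt with h | h
    · exact ⟨0, le_rfl, zero_le_one, by rw [zero_mul]; exact h⟩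
    · have hS := h.trans_le h1
      exact ⟨R₁ / ∑ l, Cs (Pl l) (a l) (b₁ l), by positivity, (div_le_one hS).2 h1, 
        div_mul_cancel₀ _ hS.ne'⟩
  set η := ε * Real.log 2 / (L + 1) with hη
  have hη0 : 0 < η := by positivity
  have hLη : L * η ≤ ε * Real.log 2 := by
    have : (L + 1) * η = ε * Real.log 2 := by rw [hη]; field_simp
    linarith
  have hb₁ : ∀ l, 0 ≤ b₁ l := fun l => (hb₂ l).trans (hb₁₂ l)
  choose N hN using fun l => scalar (a l) (b₁ l) (b₂ l) (Pl l) θ η (ha l) (hb₂ l) (hb₁₂ l) (hPl l) 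
    hθ0 hθ1 hη0
  set n := ∑ l, N l + 1 with hn
  choose k1 ka kb hk1 hka hkb hS hr1 hr2 using fun l => hN l n 
    ((Finset.single_le_sum (f := N) (fun _ _ => Nat.zero_le _) (Finset.mem_univ l)).trans (Nat.le_succ _))
  have i1 : ∀ l, Nonempty (Fin (k1 l)) := fun l => ⟨⟨0, hk1 l⟩⟩
  have i2 : ∀ l, Nonempty (Fin (ka l)) := fun l => ⟨⟨0, hka l⟩⟩
  have i3 : ∀ l, Nonempty (Fin (kb l)) := fun l => ⟨⟨0, hkb l⟩⟩
  have c1 : Fintype.card (∀ l, Fin (k1 l)) = ∏ l, k1 l := by simp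
  have c2 : Fintype.card (∀ l, Fin (ka l) × Fin (kb l)) = ∏ l, ka l * kb l := by simp
  have p1 : 0 < ∏ l, k1 l := Finset.prod_pos fun l _ => hk1 l
  have p2 : 0 < ∏ l, ka l * kb l := Finset.prod_pos fun l _ => Nat.mul_pos (hka l) (hkb l)
  have : NeZero (∏ l, k1 l) := ⟨p1.ne'⟩
  have : NeZero (∏ l, ka l * kb l) := ⟨p2.ne'⟩
  obtain ⟨enc, he, hp, dec, hd, q1, q2, q3⟩ := par_code a b₁ b₂ Pl P η hPs hη0.le 
    (Fintype.equivFinOfCardEq c1).symm (Fintype.equivFinOfCardEq c2).symm hS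
  have hn0 : (0 : ℝ) ≤ n := by positivity
  have hleak : L * (n * η) / Real.log 2 ≤ n * ε := by
    rw [div_le_iff₀ hl2]
    calc L * (n * η) = n * (L * η) := by ring
      _ ≤ n * (ε * Real.log 2) := by gcongr
      _ = _ := by ring
  have hnL := mul_le_mul_of_nonneg_left hLη hn0
  simp_rw [← Cs_eq (hPl _) (ha _) (hb₁ _), ← Cs_eq (hPl _) (ha _) (hb₂ _)] at hr1 hr2
  refine ⟨n, Nat.succ_pos _, ∏ l, k1 l, ∏ l, ka l * kb l, p1, p2, ?_, ?_, enc, he, hp, dec, hd, 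
    q1.trans ?_, q2.trans hleak, q3.trans hleak⟩
  · rw [Real.logb, le_div_iff₀ hl2, Nat.cast_prod, 
      Real.log_prod (fun l _ => by exact_mod_cast (hk1 l).ne')]
    refine le_trans ?_ (Finset.sum_le_sum fun l _ => hr1 l)
    rw [← Finset.mul_sum, Finset.sum_sub_distrib, ← Finset.mul_sum, ← Finset.sum_mul, ← mul_assoc, hθ]
    simp only [Finset.sum_const, Finset.card_univ, Fintype.card_fin, nsmul_eq_mul]
    linarith
  · rw [Real.logb, le_div_iff₀ hl2, Nat.cast_prod, 
      Real.log_prod (fun l _ => by exact_mod_cast (Nat.mul_pos (hka l) (hkb l)).ne')]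
    simp_rw [Nat.cast_mul]
    refine le_trans ?_ (Finset.sum_le_sum fun l _ => hr2 l)
    rw [← Finset.mul_sum, Finset.sum_sub_distrib, Finset.sum_sub_distrib, ← Finset.mul_sum, 
      ← Finset.sum_mul, ← Finset.sum_mul, ← mul_assoc, hθ]
    simp only [Finset.sum_const, Finset.card_univ, Fintype.card_fin, nsmul_eq_mul]
    have h3 : n * (R₂ * Real.log 2) ≤ n * ((∑ l, Cs (Pl l) (a l) (b₂ l) - R₁) * Real.log 2) := by
      gcongr; linarith
    linarith
  · exact hLη.trans (mul_le_of_le_one_right hε.le hl21)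
end WT

/-- the secrecy capacity region of the independent parallel Gaussian
two-level security wiretap channel under the average total power constraint `P` is the
union, over power allocations `(P₁,…,P_L)` with `P_l ≥ 0` and `∑ l, P_l ≤ P`, of the sets
of nonnegative pairs with `R₁ ≤ ∑ l, Cs(P_l, a l, b₁ l)` and
`R₁ + R₂ ≤ ∑ l, Cs(P_l, a l, b₂ l)`. -/
theorem stmt10_parallel_gaussian_total_power_region (L : ℕ) (a b₁ b₂ : Fin L → ℝ)
    (P : ℝ) (ha : ∀ l, 0 ≤ a l) (hb₁₂ : ∀ l, b₁ l ≥ b₂ l) (hb₂ : ∀ l, b₂ l ≥ 0)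
    (hP : 0 ≤ P) (R₁ R₂ : ℝ) (hR₁ : 0 ≤ R₁) (hR₂ : 0 ≤ R₂) :
    ParAchievable L a b₁ b₂ (totalPow L P) R₁ R₂ ↔
      ∃ Palloc : Fin L → ℝ, (∀ l, 0 ≤ Palloc l) ∧ (∑ l, Palloc l) ≤ P ∧
        R₁ ≤ ∑ l, Cs (Palloc l) (a l) (b₁ l) ∧
        R₁ + R₂ ≤ ∑ l, Cs (Palloc l) (a l) (b₂ l) := by
  constructor
  · intro h
    exact WT.converse L a b₁ b₂ P ha (fun l => (hb₂ l).trans (hb₁₂ l)) hb₂ R₁ R₂ h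
  · rintro ⟨Pl, h0, hs, h1, h2⟩
    exact WT.ach L a b₁ b₂ P ha hb₁₂ hb₂ R₁ R₂ hR₁ Pl h0 hs h1 h2
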